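/- For all integers k ≥ 1, t ≥ 2 with k + t ≥ 4 and c ∈ {0,1}, the set 𝓚 = 𝓑₁₂ ∪ 𝓑₂₁ ∪ 𝓚₁₁ ∪ 𝓚₂₂ is an F-basis of the commutator subspace K(B^{k,t}_c); in particular dim_F K(B^{k,t}_c) = 8k − 2 = dim_F B^{k,t}_c − dim_F Z(B^{k,t}_c). -/

import Mathlib

/- Common setup: the algebras B^{k,t}_c = SD(2B)₂^{k,t}(c) of semidihedral type,
   over a field F, presented as a quotient of the free algebra on the paths-generators
   e₁, e₂ (trivial paths), α (loop at vertex 1), β (arrow 1 → 2),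
   γ (arrow 2 → 1), η (loop at vertex 2), by the path-algebra relations
   together with Erdmann's relations  βη = (αβγ)^{k-1}αβ, γβ = η^{t-1},
   ηγ = (γαβ)^{k-1}γα, βη² = 0, η²γ = 0, α² = c(αβγ)^k. -/

noncomputable section

namespace SD2Paper

inductive Gen : Type
  | e1 | e2 | a | b | g | h

variable (F : Type) [Field F]

/-- The generators inside the free algebra. -/
def gen (t : Gen) : FreeAlgebra F Gen := FreeAlgebra.ι F t

/-- The defining relations of `D(2B)^{k,s}(c)` (paths written from left to right). -/
inductive Rel (k t : ℕ) (c : F) : FreeAlgebra F Gen → FreeAlgebra F Gen → Prop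
  | unit : Rel k t c (gen F .e1 + gen F .e2) 1
  | idem1 : Rel k t c (gen F .e1 * gen F .e1) (gen F .e1)
  | idem2 : Rel k t c (gen F .e2 * gen F .e2) (gen F .e2)
  | orth12 : Rel k t c (gen F .e1 * gen F .e2) 0
  | orth21 : Rel k t c (gen F .e2 * gen F .e1) 0
  | aL : Rel k t c (gen F .e1 * gen F .a) (gen F .a)
  | aR : Rel k t c (gen F .a * gen F .e1) (gen F .a)
  | bL : Rel k t c (gen F .e1 * gen F .b) (gen F .b)
  | bR : Rel k t c (gen F .b * gen F .e2) (gen F .b)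
  | gL : Rel k t c (gen F .e2 * gen F .g) (gen F .g)
  | gR : Rel k t c (gen F .g * gen F .e1) (gen F .g)
  | hL : Rel k t c (gen F .e2 * gen F .h) (gen F .h)
  | hR : Rel k t c (gen F .h * gen F .e2) (gen F .h)
  | bh : Rel k t c (gen F .b * gen F .h)
      ((gen F .a * gen F .b * gen F .g) ^ (k - 1) * (gen F .a * gen F .b))
  | gb : Rel k t c (gen F .g * gen F .b) ((gen F .h) ^ (t - 1))
  | hg : Rel k t c (gen F .h * gen F .g)
      ((gen F .g * gen F .a * gen F .b) ^ (k - 1) * (gen F .g * gen F .a))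
  | bh2 : Rel k t c (gen F .b * gen F .h * gen F .h) 0
  | h2g : Rel k t c (gen F .h * gen F .h * gen F .g) 0
  | asq : Rel k t c (gen F .a * gen F .a) (c • (gen F .a * gen F .b * gen F .g) ^ k)

/-- The algebra `B^{k,t}_c = SD(2B)₂^{k,t}(c)`. -/
def BA (k t : ℕ) (c : F) : Type := RingQuot (Rel F k t c)

instance (k t : ℕ) (c : F) : Ring (BA F k t c) :=
  inferInstanceAs (Ring (RingQuot (Rel F k t c)))

instance (k t : ℕ) (c : F) : Algebra F (BA F k t c) :=
  inferInstanceAs (Algebra F (RingQuot (Rel F k t c)))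

variable (k t : ℕ) (c : F)

/-- The canonical projection. -/
def mk : FreeAlgebra F Gen →ₐ[F] BA F k t c := RingQuot.mkAlgHom F (Rel F k t c)

def E1 : BA F k t c := mk F k t c (gen F .e1)
def E2 : BA F k t c := mk F k t c (gen F .e2)
/-- The image of the loop α at vertex 1. -/
def Al : BA F k t c := mk F k t c (gen F .a)
/-- The image of the arrow β : 1 → 2. -/
def Be : BA F k t c := mk F k t c (gen F .b)
/-- The image of the arrow γ : 2 → 1. -/
def Ga : BA F k t c := mk F k t c (gen F .g)
/-- The image of the loop η at vertex 2. -/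
def Et : BA F k t c := mk F k t c (gen F .h)

/-- The path αβγ. -/
def ABG : BA F k t c := Al F k t c * Be F k t c * Ga F k t c
/-- The path βγα. -/
def BGA : BA F k t c := Be F k t c * Ga F k t c * Al F k t c
/-- The path γαβ. -/
def GAB : BA F k t c := Ga F k t c * Al F k t c * Be F k t c

/-- The standard basis paths 𝓑₁₁ of e₁Ae₁. -/
def B11 : Set (BA F k t c) :=
  {E1 F k t c, Al F k t c, Be F k t c * Ga F k t c, (ABG F k t c) ^ k}
    ∪ (fun i => (ABG F k t c) ^ i) '' Set.Icc 1 (k - 1)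
    ∪ (fun i => (ABG F k t c) ^ i * Al F k t c) '' Set.Icc 1 (k - 1)
    ∪ (fun i => (BGA F k t c) ^ i) '' Set.Icc 1 (k - 1)
    ∪ (fun i => (BGA F k t c) ^ i * (Be F k t c * Ga F k t c)) '' Set.Icc 1 (k - 1)

/-- The standard basis paths 𝓑₁₂ of e₁Ae₂. -/
def B12 : Set (BA F k t c) :=
  {Be F k t c, Al F k t c * Be F k t c}
    ∪ (fun i => (BGA F k t c) ^ i * Be F k t c) '' Set.Icc 1 (k - 1)
    ∪ (fun i => (ABG F k t c) ^ i * (Al F k t c * Be F k t c)) '' Set.Icc 1 (k - 1)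

/-- The standard basis paths 𝓑₂₁ of e₂Ae₁. -/
def B21 : Set (BA F k t c) :=
  {Ga F k t c, Ga F k t c * Al F k t c}
    ∪ (fun i => (GAB F k t c) ^ i * Ga F k t c) '' Set.Icc 1 (k - 1)
    ∪ (fun i => (GAB F k t c) ^ i * (Ga F k t c * Al F k t c)) '' Set.Icc 1 (k - 1)

/-- The standard basis paths 𝓑₂₂ of e₂Ae₂. -/
def B22 : Set (BA F k t c) :=
  {E2 F k t c}
    ∪ (fun i => (GAB F k t c) ^ i) '' Set.Icc 1 (k - 1)
    ∪ (fun j => (Et F k t c) ^ j) '' Set.Icc 1 t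

/-- The standard path basis 𝓑 of `A^{k,s}_c`. -/
def BB : Set (BA F k t c) :=
  B11 F k t c ∪ B12 F k t c ∪ B21 F k t c ∪ B22 F k t c

/-- The commutator subspace K(A): the F-linear span of all commutators. -/
def Kspan (A : Type) [Ring A] [Algebra F A] : Submodule F A :=
  Submodule.span F {z : A | ∃ u v : A, z = u * v - v * u}

/-- The (left) socle of a ring: the sum of all simple (left) submodules. -/
def socle (A : Type) [Ring A] : Submodule A A := sSup {S : Submodule A A | IsAtom S}

/-- `ψ` is the linear form sending each standard basis path lying in the socle to 1
    and every other standard basis path to 0. -/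
def SoclePsi (ψ : BA F k t c →ₗ[F] F) : Prop :=
  ∀ p ∈ BB F k t c,
    (p ∈ socle (BA F k t c) → ψ p = 1) ∧ (p ∉ socle (BA F k t c) → ψ p = 0)

/-- `T₁(A) = {x : x² ∈ K(A)}`. -/
def T1set : Set (BA F k t c) := {z | z ^ 2 ∈ Kspan F (BA F k t c)}

/-- The orthogonal space `T₁(A)^⊥` with respect to the form `⟨x, y⟩ = ψ(xy)`. -/
def T1perp (ψ : BA F k t c →ₗ[F] F) : Set (BA F k t c) :=
  {y | ∀ x ∈ T1set F k t c, ψ (y * x) = 0}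

/-- The first generalized Reynolds ideal, as an ideal of the center `Z(A)`. -/
def ReynoldsIdeal (ψ : BA F k t c →ₗ[F] F) :
    Ideal (Subalgebra.center F (BA F k t c)) :=
  Ideal.span {z : Subalgebra.center F (BA F k t c) | (z : BA F k t c) ∈ T1perp F k t c ψ}


/-- The set 𝓚₁₁ (semidihedral type, second family). -/
def K11 : Set (BA F k t c) :=
  {Be F k t c * Ga F k t c + Ga F k t c * Be F k t c}
    ∪ (fun i => (ABG F k t c) ^ i + (BGA F k t c) ^ i) '' Set.Icc 1 (k - 1)
    ∪ (fun i => (ABG F k t c) ^ i * Al F k t c) '' Set.Icc 1 (k - 1)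
    ∪ (fun i => (BGA F k t c) ^ i * (Be F k t c * Ga F k t c)) '' Set.Icc 1 (k - 1)

/-- The set 𝓚₂₂ (semidihedral type, second family). -/
def K22 : Set (BA F k t c) :=
  (fun i => (ABG F k t c) ^ i + (GAB F k t c) ^ i) '' Set.Icc 1 k

/-- The set 𝓚 = 𝓑₁₂ ∪ 𝓑₂₁ ∪ 𝓚₁₁ ∪ 𝓚₂₂, a basis of the commutator subspace. -/
def KK : Set (BA F k t c) :=
  B12 F k t c ∪ B21 F k t c ∪ K11 F k t c ∪ K22 F k t c

section Presentation

variable {F k t c}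

/-- Elements of an algebra satisfying the defining relations of `BA F k t c`. -/
structure SDRels (k t : ℕ) (c : F) {A : Type} [Ring A] [Algebra F A]
    (e1 e2 a b g h : A) : Prop where
  unit : e1 + e2 = 1
  idem1 : e1 * e1 = e1
  idem2 : e2 * e2 = e2
  orth12 : e1 * e2 = 0
  orth21 : e2 * e1 = 0
  aL : e1 * a = a
  aR : a * e1 = a
  bL : e1 * b = b
  bR : b * e2 = b
  gL : e2 * g = g
  gR : g * e1 = g
  hL : e2 * h = h
  hR : h * e2 = h
  bh : b * h = (a * b * g) ^ (k - 1) * (a * b)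
  gb : g * b = h ^ (t - 1)
  hg : h * g = (g * a * b) ^ (k - 1) * (g * a)
  bh2 : b * h * h = 0
  h2g : h * h * g = 0
  asq : a * a = c • (a * b * g) ^ k

theorem sdRels_BA : SDRels k t c (E1 F k t c) (E2 F k t c) (Al F k t c) (Be F k t c)
    (Ga F k t c) (Et F k t c) := by
  have H : ∀ {x y}, Rel F k t c x y → mk F k t c x = mk F k t c y :=
    fun h => RingQuot.mkAlgHom_rel F h
  constructor <;> simp only [E1, E2, Al, Be, Ga, Et, ← map_mul, ← map_pow, ← map_smul,
    ← map_add]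
  · rw [H .unit, map_one]
  · exact H .idem1
  · exact H .idem2
  · rw [H .orth12, map_zero]
  · rw [H .orth21, map_zero]
  · exact H .aL
  · exact H .aR
  · exact H .bL
  · exact H .bR
  · exact H .gL
  · exact H .gR
  · exact H .hL
  · exact H .hR
  · exact H .bh
  · exact H .gb
  · exact H .hg
  · rw [H .bh2, map_zero]
  · rw [H .h2g, map_zero]
  · exact H .asq

/-- Any solution of the defining relations receives a homomorphism from `BA F k t c`. -/
theorem SDRels.exists_lift {A : Type} [Ring A] [Algebra F A] {e1 e2 a b g h : A}
    (R : SDRels k t c e1 e2 a b g h) : ∃ f : BA F k t c →ₐ[F] A,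
      f (E1 F k t c) = e1 ∧ f (E2 F k t c) = e2 ∧ f (Al F k t c) = a ∧
      f (Be F k t c) = b ∧ f (Ga F k t c) = g ∧ f (Et F k t c) = h := by
  let v : Gen → A := fun
    | .e1 => e1
    | .e2 => e2
    | .a => a
    | .b => b
    | .g => g
    | .h => h
  have hv : ∀ s, FreeAlgebra.lift F v (gen F s) = v s := fun s => by simp [gen]
  have key : ∀ ⦃x y⦄, Rel F k t c x y → FreeAlgebra.lift F v x = FreeAlgebra.lift F v y := by
    intro x y hxy
    cases hxy <;> simp only [map_mul, map_add, map_pow, map_smul, map_one, map_zero, hv, v]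
    exacts [R.unit, R.idem1, R.idem2, R.orth12, R.orth21, R.aL, R.aR, R.bL, R.bR, R.gL, R.gR,
      R.hL, R.hR, R.bh, R.gb, R.hg, R.bh2, R.h2g, R.asq]
  have hf : ∀ s, RingQuot.liftAlgHom F ⟨FreeAlgebra.lift F v, key⟩ (SD2Paper.mk F k t c (gen F s)) =
      v s := fun s => (RingQuot.liftAlgHom_mkAlgHom_apply F _ key _).trans (hv s)
  exact ⟨RingQuot.liftAlgHom F ⟨FreeAlgebra.lift F v, key⟩, hf .e1, hf .e2, hf .a, hf .b, hf .g,
    hf .h⟩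

theorem adjoin_BA : Algebra.adjoin F {E1 F k t c, E2 F k t c, Al F k t c, Be F k t c,
    Ga F k t c, Et F k t c} = ⊤ := by
  rw [eq_top_iff]
  intro x _
  obtain ⟨y, rfl⟩ : ∃ y, mk F k t c y = x := RingQuot.mkAlgHom_surjective F _ x
  induction y using FreeAlgebra.induction with
  | grade0 r => rw [AlgHom.commutes]; exact Subalgebra.algebraMap_mem _ r
  | grade1 s => apply Algebra.subset_adjoin; cases s <;> simp [E1, E2, Al, Be, Ga, Et, gen]
  | mul x y hx hy => rw [map_mul]; exact mul_mem (hx trivial) (hy trivial)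
  | add x y hx hy => rw [map_add]; exact add_mem (hx trivial) (hy trivial)

end Presentation

section Paths

variable {F k t c}
variable {A : Type} [Ring A] [Algebra F A] {e1 e2 a b g h : A}

/-- `x` is a combination of paths from the vertex of `e` to the vertex of `f`. -/
def IsPath (e f x : A) : Prop := e * x = x ∧ x * f = x

theorem IsPath.mul {e f f' x y : A} (hx : IsPath e f x) (hy : IsPath f f' y) :
    IsPath e f' (x * y) :=
  ⟨by rw [← mul_assoc, hx.1], by rw [mul_assoc, hy.2]⟩

theorem IsPath.mul_eq_zero {e f e' f' x y : A} (hx : IsPath e f x) (hy : IsPath e' f' y)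
    (h0 : f * e' = 0) : x * y = 0 := by
  rw [← hx.2, ← hy.1, mul_assoc, ← mul_assoc f, h0, zero_mul, mul_zero]

theorem IsPath.pow_mul {e f x y : A} (hx : IsPath e e x) (hy : IsPath e f y) (n : ℕ) :
    IsPath e f (x ^ n * y) := by
  induction n with
  | zero => simpa using hy
  | succ n ih => rw [pow_succ', mul_assoc]; exact hx.mul ih

theorem IsPath.pow_succ {e x : A} (hx : IsPath e e x) (n : ℕ) : IsPath e e (x ^ (n + 1)) := by
  rw [_root_.pow_succ]; exact hx.pow_mul hx n

theorem mul_rotate_pow {M : Type} [Monoid M] (x y z : M) (n : ℕ) :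
    x * (y * z * x) ^ n = (x * y * z) ^ n * x := by
  rw [← mul_pow_mul, ← mul_assoc]

/-- The idempotents of the two vertices. -/
def vertex (e1 e2 : A) (i : Bool) : A := bif i then e2 else e1

/-- The four arrows, with their source and target. -/
inductive IsArrow (a b g h : A) : Bool → Bool → A → Prop
  | a : IsArrow a b g h false false a
  | b : IsArrow a b g h false true b
  | g : IsArrow a b g h true false g
  | h : IsArrow a b g h true true h

/-- The normal forms of paths, with their source and target. -/
inductive NormalPath (e1 e2 a b g h : A) : Bool → Bool → A → Prop
  | e1 : NormalPath e1 e2 a b g h false false e1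
  | u (n : ℕ) : NormalPath e1 e2 a b g h false false ((a * b * g) ^ (n + 1))
  | ua (n : ℕ) : NormalPath e1 e2 a b g h false false ((a * b * g) ^ n * a)
  | v (n : ℕ) : NormalPath e1 e2 a b g h false false ((b * g * a) ^ (n + 1))
  | vbg (n : ℕ) : NormalPath e1 e2 a b g h false false ((b * g * a) ^ n * (b * g))
  | vb (n : ℕ) : NormalPath e1 e2 a b g h false true ((b * g * a) ^ n * b)
  | uab (n : ℕ) : NormalPath e1 e2 a b g h false true ((a * b * g) ^ n * (a * b))
  | wg (n : ℕ) : NormalPath e1 e2 a b g h true false ((g * a * b) ^ n * g)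
  | wga (n : ℕ) : NormalPath e1 e2 a b g h true false ((g * a * b) ^ n * (g * a))
  | e2 : NormalPath e1 e2 a b g h true true e2
  | w (n : ℕ) : NormalPath e1 e2 a b g h true true ((g * a * b) ^ (n + 1))
  | h (n : ℕ) : NormalPath e1 e2 a b g h true true (h ^ (n + 1))

namespace SDRels

variable (R : SDRels k t c e1 e2 a b g h)
include R

theorem vertex_mul_of_ne {i j : Bool} (hij : i ≠ j) : vertex e1 e2 i * vertex e1 e2 j = 0 := by
  cases i <;> cases j <;> simp_all [vertex, R.orth12, R.orth21]

theorem vertex_mul_self (i : Bool) : vertex e1 e2 i * vertex e1 e2 i = vertex e1 e2 i := by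
  cases i <;> simp [vertex, R.idem1, R.idem2]

theorem isPath_arrow {i j : Bool} {x : A} (hx : IsArrow a b g h i j x) :
    IsPath (vertex e1 e2 i) (vertex e1 e2 j) x := by
  cases hx
  exacts [⟨R.aL, R.aR⟩, ⟨R.bL, R.bR⟩, ⟨R.gL, R.gR⟩, ⟨R.hL, R.hR⟩]

theorem isPath_normalPath {i j : Bool} {x : A} (hx : NormalPath e1 e2 a b g h i j x) :
    IsPath (vertex e1 e2 i) (vertex e1 e2 j) x := by
  have pa := R.isPath_arrow .a
  have pb := R.isPath_arrow .b
  have pg := R.isPath_arrow .g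
  have ph := R.isPath_arrow .h
  have pu := (pa.mul pb).mul pg
  have pv := (pb.mul pg).mul pa
  have pw := (pg.mul pa).mul pb
  cases hx with
  | e1 => exact ⟨R.idem1, R.idem1⟩
  | u n => exact pu.pow_succ n
  | ua n => exact pu.pow_mul pa n
  | v n => exact pv.pow_succ n
  | vbg n => exact pv.pow_mul (pb.mul pg) n
  | vb n => exact pv.pow_mul pb n
  | uab n => exact pu.pow_mul (pa.mul pb) n
  | wg n => exact pw.pow_mul pg n
  | wga n => exact pw.pow_mul (pg.mul pa) n
  | e2 => exact ⟨R.idem2, R.idem2⟩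
  | w n => exact pw.pow_succ n
  | h n => exact ph.pow_succ n

theorem h_pow_g (n : ℕ) : h ^ (n + 2) * g = 0 := by
  rw [pow_add, pow_two, mul_assoc, R.h2g, mul_zero]

theorem b_h_pow (n : ℕ) : b * h ^ (n + 2) = 0 := by
  rw [add_comm, pow_add, pow_two, ← mul_assoc, ← mul_assoc, R.bh2, zero_mul]

section

variable (hk : 1 ≤ k)
include hk

theorem b_h_g : b * h * g = (a * b * g) ^ k := by
  obtain ⟨k, rfl⟩ := Nat.exists_eq_add_of_le' hk
  rw [R.bh, pow_succ, Nat.add_sub_cancel, mul_assoc]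

theorem u_pow_eq : (a * b * g) ^ k = (b * g * a) ^ k := by
  rw [← R.b_h_g hk]
  obtain ⟨k, rfl⟩ := Nat.exists_eq_add_of_le' hk
  rw [mul_assoc, R.hg, ← mul_assoc, mul_rotate_pow, pow_succ]; simp [mul_assoc]

variable (ht : 2 ≤ t)
include ht

theorem h_pow_eq : h ^ t = (g * a * b) ^ k := by
  obtain ⟨k, rfl⟩ := Nat.exists_eq_add_of_le' hk
  obtain ⟨t, rfl⟩ := Nat.exists_eq_add_of_le' ht
  rw [pow_succ' h, show h ^ (t + 1) = g * b from R.gb.symm, ← mul_assoc, R.hg, pow_succ]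
  simp [mul_assoc]

theorem g_u_pow : g * (a * b * g) ^ k = 0 := by
  obtain ⟨t, rfl⟩ := Nat.exists_eq_add_of_le' ht
  rw [← R.b_h_g hk, mul_assoc, ← mul_assoc, R.gb, ← mul_assoc, Nat.add_succ_sub_one,
    ← pow_succ, R.h_pow_g]

theorem a_a_b : a * a * b = 0 := by
  obtain ⟨t, rfl⟩ := Nat.exists_eq_add_of_le' ht
  rw [R.asq, smul_mul_assoc, ← R.b_h_g hk, mul_assoc, R.gb, Nat.add_succ_sub_one, mul_assoc,
    ← pow_succ', R.b_h_pow, smul_zero]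

theorem g_a_a : g * (a * a) = 0 := by
  rw [R.asq, mul_smul_comm, R.g_u_pow hk ht, smul_zero]

theorem a_u_pow : a * (a * b * g) ^ k = 0 := by
  obtain ⟨k, rfl⟩ := Nat.exists_eq_add_of_le' hk
  rw [pow_succ', ← mul_assoc, ← mul_assoc, ← mul_assoc, R.a_a_b hk ht, zero_mul, zero_mul]

theorem u_pow_a : (a * b * g) ^ k * a = 0 := by
  rw [← mul_rotate_pow, ← R.u_pow_eq hk, R.a_u_pow hk ht]

theorem u_pow_b : (a * b * g) ^ k * b = 0 := by
  obtain ⟨t, rfl⟩ := Nat.exists_eq_add_of_le' ht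
  rw [← R.b_h_g hk, mul_assoc, R.gb, Nat.add_succ_sub_one, mul_assoc, ← pow_succ', R.b_h_pow]

theorem h_g_a : h * g * a = 0 := by
  rw [R.hg, mul_assoc _ (g * a), mul_assoc g a a, R.g_a_a hk ht, mul_zero]

theorem a_b_h : a * b * h = 0 := by
  obtain ⟨k, rfl⟩ := Nat.exists_eq_add_of_le' hk
  rw [mul_assoc, R.bh, Nat.add_sub_cancel, ← mul_assoc _ a b, ← mul_rotate_pow, ← mul_assoc,
    ← mul_assoc, R.asq, smul_mul_assoc, smul_mul_assoc, mul_assoc, ← mul_rotate_pow, ← mul_assoc,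
    R.u_pow_b hk ht, zero_mul, smul_zero]

theorem h_pow_g_a (n : ℕ) : h ^ (n + 1) * g * a = 0 := by
  rw [pow_succ, mul_assoc, mul_assoc, ← mul_assoc h, R.h_g_a hk ht, mul_zero]

theorem g_b_g_a : g * b * g * a = 0 := by
  obtain ⟨t, rfl⟩ := Nat.exists_eq_add_of_le' ht
  rw [R.gb, Nat.add_succ_sub_one, R.h_pow_g_a hk ht]

theorem a_b_h_pow (n : ℕ) : a * b * h ^ (n + 1) = 0 := by
  rw [pow_succ', ← mul_assoc, R.a_b_h hk ht, zero_mul]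

theorem a_b_g_b : a * b * g * b = 0 := by
  obtain ⟨t, rfl⟩ := Nat.exists_eq_add_of_le' ht
  rw [mul_assoc, R.gb, Nat.add_succ_sub_one, R.a_b_h_pow hk ht]

theorem ua_eq_zero {n : ℕ} (hn : k ≤ n) : (a * b * g) ^ n * a = 0 := by
  obtain ⟨m, rfl⟩ := Nat.exists_eq_add_of_le' hn
  rw [pow_add, mul_assoc, R.u_pow_a hk ht, mul_zero]

theorem uab_eq_zero {n : ℕ} (hn : k ≤ n) : (a * b * g) ^ n * (a * b) = 0 := by
  rw [← mul_assoc, R.ua_eq_zero hk ht hn, zero_mul]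

theorem u_eq_zero {n : ℕ} (hn : k ≤ n) : (a * b * g) ^ (n + 1) = 0 := by
  rw [pow_succ, ← mul_assoc, R.uab_eq_zero hk ht hn, zero_mul]

theorem vb_eq_zero {n : ℕ} (hn : k ≤ n) : (b * g * a) ^ n * b = 0 := by
  obtain ⟨m, rfl⟩ := Nat.exists_eq_add_of_le' hn
  rw [pow_add, mul_assoc, ← R.u_pow_eq hk, R.u_pow_b hk ht, mul_zero]

theorem vbg_eq_zero {n : ℕ} (hn : k ≤ n) : (b * g * a) ^ n * (b * g) = 0 := by
  rw [← mul_assoc, R.vb_eq_zero hk ht hn, zero_mul]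

theorem v_eq_zero {n : ℕ} (hn : k ≤ n) : (b * g * a) ^ (n + 1) = 0 := by
  rw [pow_succ, ← mul_assoc, R.vbg_eq_zero hk ht hn, zero_mul]

theorem wg_eq_zero {n : ℕ} (hn : k ≤ n) : (g * a * b) ^ n * g = 0 := by
  obtain ⟨m, rfl⟩ := Nat.exists_eq_add_of_le' hn
  rw [pow_add, mul_assoc, ← mul_rotate_pow, R.g_u_pow hk ht, mul_zero]

theorem wga_eq_zero {n : ℕ} (hn : k ≤ n) : (g * a * b) ^ n * (g * a) = 0 := by
  rw [← mul_assoc, R.wg_eq_zero hk ht hn, zero_mul]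

theorem w_eq_zero {n : ℕ} (hn : k ≤ n) : (g * a * b) ^ (n + 1) = 0 := by
  rw [pow_succ, ← mul_assoc, R.wga_eq_zero hk ht hn, zero_mul]

theorem h_pow_eq_zero {n : ℕ} (hn : t < n) : h ^ n = 0 := by
  obtain ⟨m, rfl⟩ := Nat.exists_eq_add_of_lt hn
  obtain ⟨k, rfl⟩ := Nat.exists_eq_add_of_le' hk
  obtain ⟨t, rfl⟩ := Nat.exists_eq_add_of_le' ht
  rw [show t + 2 + m + 1 = (m + 1) + (t + 2) by omega, pow_add, R.h_pow_eq hk ht,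
    pow_succ' (g * a * b), ← mul_assoc, ← mul_assoc, ← mul_assoc, R.h_pow_g_a hk ht, zero_mul, zero_mul]

theorem arrow_mul_normalPath_mem {i j l : Bool} {x y : A} (hx : IsArrow a b g h i j x)
    (hy : NormalPath e1 e2 a b g h j l y) :
    x * y ∈ Submodule.span F {z | ∃ p q, NormalPath e1 e2 a b g h p q z} := by
  have mem : ∀ {p q z}, NormalPath e1 e2 a b g h p q z →
      z ∈ Submodule.span F {z | ∃ p q, NormalPath e1 e2 a b g h p q z} :=
    fun H => Submodule.subset_span ⟨_, _, H⟩
  have hgmem : h * g ∈ Submodule.span F {z | ∃ p q, NormalPath e1 e2 a b g h p q z} := by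
    rw [R.hg]; exact mem (.wga _)
  obtain ⟨s, rfl⟩ := Nat.exists_eq_add_of_le' ht
  have hgb : g * b = h ^ (s + 1) := R.gb
  cases hx with
  | a =>
    cases hy with
    | e1 => rw [R.aR]; simpa using mem (.ua 0)
    | u n =>
      rw [pow_succ', ← mul_assoc, ← mul_assoc, ← mul_assoc, R.a_a_b hk ht, zero_mul, zero_mul]
      exact zero_mem _
    | ua n =>
      cases n with
      | zero =>
        rw [pow_zero, one_mul, R.asq]
        obtain ⟨k, rfl⟩ := Nat.exists_eq_add_of_le' hk
        exact Submodule.smul_mem _ _ (mem (.u k))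
      | succ n =>
        rw [pow_succ', ← mul_assoc, ← mul_assoc, ← mul_assoc, ← mul_assoc, R.a_a_b hk ht]
        simp
    | v n => rw [mul_rotate_pow]; exact mem (.ua _)
    | vbg n =>
      rw [← mul_assoc, mul_rotate_pow, mul_assoc, ← mul_assoc a, ← pow_succ]; exact mem (.u _)
    | vb n => rw [← mul_assoc, mul_rotate_pow, mul_assoc]; exact mem (.uab _)
    | uab n =>
      cases n with
      | zero => rw [pow_zero, one_mul, ← mul_assoc, R.a_a_b hk ht]; exact zero_mem _
      | succ n =>
        rw [pow_succ', ← mul_assoc, ← mul_assoc, ← mul_assoc, ← mul_assoc,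
          ← mul_assoc, R.a_a_b hk ht]
        simp
  | b =>
    cases hy with
    | wg n => rw [← mul_assoc, mul_rotate_pow, mul_assoc]; exact mem (.vbg _)
    | wga n =>
      rw [← mul_assoc, mul_rotate_pow, mul_assoc, ← mul_assoc b, ← pow_succ]; exact mem (.v _)
    | e2 => rw [R.bR]; simpa using mem (.vb 0)
    | w n => rw [mul_rotate_pow]; exact mem (.vb _)
    | h n =>
      cases n with
      | zero => rw [zero_add, pow_one, R.bh]; exact mem (.uab _)
      | succ n => rw [R.b_h_pow]; exact zero_mem _
  | g =>
    cases hy with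
    | e1 => rw [R.gR]; simpa using mem (.wg 0)
    | u n => rw [mul_rotate_pow]; exact mem (.wg _)
    | ua n => rw [← mul_assoc, mul_rotate_pow, mul_assoc]; exact mem (.wga _)
    | v n =>
      rw [pow_succ', ← mul_assoc, ← mul_assoc, ← mul_assoc, R.g_b_g_a hk ht, zero_mul]
      exact zero_mem _
    | vbg n =>
      cases n with
      | zero =>
        rw [pow_zero, one_mul, ← mul_assoc, hgb]
        cases s with
        | zero => simpa using hgmem
        | succ s => rw [R.h_pow_g]; exact zero_mem _
      | succ n =>
        rw [pow_succ', ← mul_assoc, ← mul_assoc, ← mul_assoc, ← mul_assoc,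
          ← mul_assoc, R.g_b_g_a hk ht]
        simp
    | vb n =>
      cases n with
      | zero => rw [pow_zero, one_mul, hgb]; exact mem (.h _)
      | succ n =>
        rw [pow_succ', ← mul_assoc, ← mul_assoc, ← mul_assoc, ← mul_assoc, R.g_b_g_a hk ht]
        simp
    | uab n =>
      rw [← mul_assoc, mul_rotate_pow, mul_assoc, ← mul_assoc g, ← pow_succ]; exact mem (.w _)
  | h =>
    cases hy with
    | wg n =>
      cases n with
      | zero => simpa using hgmem
      | succ n =>
        rw [pow_succ', ← mul_assoc, ← mul_assoc, ← mul_assoc, ← mul_assoc, R.h_g_a hk ht]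
        simp
    | wga n =>
      cases n with
      | zero => rw [pow_zero, one_mul, ← mul_assoc, R.h_g_a hk ht]; exact zero_mem _
      | succ n =>
        rw [pow_succ', ← mul_assoc, ← mul_assoc, ← mul_assoc, ← mul_assoc,
          ← mul_assoc, R.h_g_a hk ht]
        simp
    | e2 => rw [R.hR]; simpa using mem (.h 0)
    | w n =>
      rw [pow_succ', ← mul_assoc, ← mul_assoc, ← mul_assoc, R.h_g_a hk ht, zero_mul, zero_mul]
      exact zero_mem _
    | h n => rw [← pow_succ']; exact mem (.h _)

omit hk ht in
theorem mul_normalPath_eq_zero {i j p q : Bool} {x y : A}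
    (hx : IsPath (vertex e1 e2 i) (vertex e1 e2 j) x)
    (hy : IsPath (vertex e1 e2 p) (vertex e1 e2 q) y) (hjp : j ≠ p) : x * y = 0 :=
  hx.mul_eq_zero hy (R.vertex_mul_of_ne hjp)

theorem span_normalPath (hgen : Algebra.adjoin F {e1, e2, a, b, g, h} = ⊤) :
    Submodule.span F {z | ∃ p q, NormalPath e1 e2 a b g h p q z} = ⊤ := by
  set M := Submodule.span F {z | ∃ p q, NormalPath e1 e2 a b g h p q z} with hM
  have hvertex : ∀ i, ∀ y ∈ M, vertex e1 e2 i * y ∈ M := by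
    intro i y hy
    refine Submodule.span_induction (p := fun y _ => vertex e1 e2 i * y ∈ M) ?_ (by simp)
      (fun x y _ _ hx hy => by rw [mul_add]; exact add_mem hx hy)
      (fun r x _ hx => by rw [mul_smul_comm]; exact M.smul_mem r hx) hy
    rintro y ⟨p, q, H⟩
    have hp := (R.isPath_normalPath H).1
    rw [← hp, ← mul_assoc]
    by_cases hip : i = p
    · rw [hip, R.vertex_mul_self, hp]; exact Submodule.subset_span ⟨_, _, H⟩
    · rw [R.vertex_mul_of_ne hip, zero_mul]; exact zero_mem _
  have harrow : ∀ {i j x}, IsArrow a b g h i j x → ∀ y ∈ M, x * y ∈ M := by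
    intro i j x hx y hy
    refine Submodule.span_induction (p := fun y _ => x * y ∈ M) ?_ (by simp)
      (fun x y _ _ hx hy => by rw [mul_add]; exact add_mem hx hy)
      (fun r x _ hx => by rw [mul_smul_comm]; exact M.smul_mem r hx) hy
    rintro y ⟨p, q, H⟩
    by_cases hjp : j = p
    · subst hjp; exact R.arrow_mul_normalPath_mem hk ht hx H
    · rw [R.mul_normalPath_eq_zero (R.isPath_arrow hx) (R.isPath_normalPath H) hjp]
      exact zero_mem _
  have hone : (1 : A) ∈ M := by
    rw [← R.unit]
    exact add_mem (Submodule.subset_span ⟨_, _, .e1⟩) (Submodule.subset_span ⟨_, _, .e2⟩)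
  rw [eq_top_iff]
  intro x _
  have hx : x ∈ Algebra.adjoin F {e1, e2, a, b, g, h} := hgen ▸ trivial
  suffices ∀ y ∈ M, x * y ∈ M by simpa using this 1 hone
  induction hx using Algebra.adjoin_induction with
  | mem x hx =>
    rcases hx with rfl | rfl | rfl | rfl | rfl | rfl
    exacts [hvertex false, hvertex true, harrow .a, harrow .b, harrow .g, harrow .h]
  | algebraMap r =>
    intro y hy
    rw [← Algebra.smul_def]; exact M.smul_mem r hy
  | add x y _ _ hx hy =>
    intro z hz
    rw [add_mul]; exact add_mem (hx trivial z hz) (hy trivial z hz)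
  | mul x y _ _ hx hy =>
    intro z hz
    rw [mul_assoc]; exact hx trivial _ (hy trivial z hz)

omit R hk ht

/-- The proposed basis of the commutator subspace, as a family. -/
def commutatorFamily (k : ℕ) (a b g : A) :
    (Fin k ⊕ Fin k ⊕ Fin k ⊕ Fin k) ⊕ (Unit ⊕ Fin (k - 1) ⊕ Fin (k - 1) ⊕ Fin (k - 1)) ⊕
      Fin k → A :=
  Sum.elim
    (Sum.elim (fun n => (b * g * a) ^ n.1 * b) <|
      Sum.elim (fun n => (a * b * g) ^ n.1 * (a * b)) <|
      Sum.elim (fun n => (g * a * b) ^ n.1 * g) fun n => (g * a * b) ^ n.1 * (g * a)) <|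
  Sum.elim
    (Sum.elim (fun _ => b * g + g * b) <|
      Sum.elim (fun n => (a * b * g) ^ (n.1 + 1) + (b * g * a) ^ (n.1 + 1)) <|
      Sum.elim (fun n => (a * b * g) ^ (n.1 + 1) * a)
        fun n => (b * g * a) ^ (n.1 + 1) * (b * g))
    fun n => (a * b * g) ^ (n.1 + 1) + (g * a * b) ^ (n.1 + 1)

/-- A family which complements `commutatorFamily` to a basis of the algebra. -/
def complementFamily (k t : ℕ) (e1 e2 a b g h : A) :
    (Unit ⊕ Unit ⊕ Unit) ⊕ Fin k ⊕ Fin (t - 1) → A :=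
  Sum.elim
    (Sum.elim (fun _ => e1) <| Sum.elim (fun _ => e2) fun _ => a) <|
    Sum.elim (fun n => (a * b * g) ^ (n.1 + 1)) fun n => h ^ (n.1 + 1)

/-- The span of `commutatorFamily`. -/
def commutatorSpan (F : Type) [Field F] {A : Type} [Ring A] [Algebra F A] (k : ℕ)
    (a b g : A) : Submodule F A :=
  Submodule.span F (Set.range (commutatorFamily k a b g))

include R hk ht

theorem v_a (n : ℕ) : (b * g * a) ^ (n + 1) * a = 0 := by
  rw [pow_succ, mul_assoc, mul_assoc _ a a, mul_assoc b g (a * a), R.g_a_a hk ht, mul_zero, mul_zero]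

theorem w_h (n : ℕ) : (g * a * b) ^ (n + 1) * h = 0 := by
  rw [pow_succ, mul_assoc, mul_assoc g a b, mul_assoc g, R.a_b_h hk ht, mul_zero, mul_zero]

theorem vb_mem (n : ℕ) : (b * g * a) ^ n * b ∈ commutatorSpan F k a b g := by
  by_cases hn : n < k
  · exact Submodule.subset_span ⟨.inl (.inl ⟨n, hn⟩), rfl⟩
  · rw [R.vb_eq_zero hk ht (not_lt.1 hn)]; exact zero_mem _

theorem uab_mem (n : ℕ) : (a * b * g) ^ n * (a * b) ∈ commutatorSpan F k a b g := by
  by_cases hn : n < k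
  · exact Submodule.subset_span ⟨.inl (.inr (.inl ⟨n, hn⟩)), rfl⟩
  · rw [R.uab_eq_zero hk ht (not_lt.1 hn)]; exact zero_mem _

theorem wg_mem (n : ℕ) : (g * a * b) ^ n * g ∈ commutatorSpan F k a b g := by
  by_cases hn : n < k
  · exact Submodule.subset_span ⟨.inl (.inr (.inr (.inl ⟨n, hn⟩))), rfl⟩
  · rw [R.wg_eq_zero hk ht (not_lt.1 hn)]; exact zero_mem _

theorem wga_mem (n : ℕ) : (g * a * b) ^ n * (g * a) ∈ commutatorSpan F k a b g := by
  by_cases hn : n < k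
  · exact Submodule.subset_span ⟨.inl (.inr (.inr (.inr ⟨n, hn⟩))), rfl⟩
  · rw [R.wga_eq_zero hk ht (not_lt.1 hn)]; exact zero_mem _

theorem ua_mem (n : ℕ) : (a * b * g) ^ (n + 1) * a ∈ commutatorSpan F k a b g := by
  by_cases hn : n < k - 1
  · exact Submodule.subset_span ⟨.inr (.inl (.inr (.inr (.inl ⟨n, hn⟩)))), rfl⟩
  · rw [R.ua_eq_zero hk ht (by omega)]; exact zero_mem _

theorem vbg_mem (n : ℕ) : (b * g * a) ^ (n + 1) * (b * g) ∈ commutatorSpan F k a b g := by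
  by_cases hn : n < k - 1
  · exact Submodule.subset_span ⟨.inr (.inl (.inr (.inr (.inr ⟨n, hn⟩)))), rfl⟩
  · rw [R.vbg_eq_zero hk ht (by omega)]; exact zero_mem _

theorem u_add_w_mem (n : ℕ) :
    (a * b * g) ^ (n + 1) + (g * a * b) ^ (n + 1) ∈ commutatorSpan F k a b g := by
  by_cases hn : n < k
  · exact Submodule.subset_span ⟨.inr (.inr ⟨n, hn⟩), rfl⟩
  · rw [R.u_eq_zero hk ht (not_lt.1 hn), R.w_eq_zero hk ht (not_lt.1 hn), add_zero]
    exact zero_mem _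

omit R hk ht in
theorem bg_add_gb_mem : b * g + g * b ∈ commutatorSpan F k a b g :=
  Submodule.subset_span ⟨.inr (.inl (.inl ())), rfl⟩

variable (h2 : (2 : F) = 0)
include h2

omit R hk ht in
theorem sub_eq_add_of_two_eq_zero (x y : A) : x - y = x + y := by
  rw [sub_eq_iff_eq_add, add_assoc, ← two_smul F y, h2, zero_smul, add_zero]

theorem u_add_v_mem (n : ℕ) :
    (a * b * g) ^ (n + 1) + (b * g * a) ^ (n + 1) ∈ commutatorSpan F k a b g := by
  rcases lt_trichotomy (n + 1) k with hn | hn | hn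
  · exact Submodule.subset_span ⟨.inr (.inl (.inr (.inl ⟨n, by omega⟩))), rfl⟩
  · rw [hn, ← R.u_pow_eq hk, ← sub_eq_add_of_two_eq_zero h2, sub_self]; exact zero_mem _
  · rw [R.u_eq_zero hk ht (by omega), R.v_eq_zero hk ht (by omega), add_zero]
    exact zero_mem _

theorem span_families (hgen : Algebra.adjoin F {e1, e2, a, b, g, h} = ⊤) :
    Submodule.span F (Set.range
      (Sum.elim (commutatorFamily k a b g) (complementFamily k t e1 e2 a b g h))) = ⊤ := by
  rw [eq_top_iff, ← R.span_normalPath hk ht hgen, Submodule.span_le, Set.Sum.elim_range]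
  set M := Submodule.span F (Set.range (commutatorFamily k a b g) ∪
    Set.range (complementFamily k t e1 e2 a b g h)) with hM
  have hS : commutatorSpan F k a b g ≤ M := Submodule.span_mono Set.subset_union_left
  have hC : ∀ i, complementFamily k t e1 e2 a b g h i ∈ M :=
    fun i => Submodule.subset_span (.inr ⟨i, rfl⟩)
  have hu : ∀ n, (a * b * g) ^ (n + 1) ∈ M := by
    intro n
    by_cases hn : n < k
    · exact hC (.inr (.inl ⟨n, hn⟩))
    · rw [R.u_eq_zero hk ht (not_lt.1 hn)]; exact zero_mem _
  have hw : ∀ n, (g * a * b) ^ (n + 1) ∈ M := fun n => by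
    simpa using M.sub_mem (hS (R.u_add_w_mem hk ht n)) (hu n)
  have hh : ∀ n, h ^ (n + 1) ∈ M := by
    intro n
    rcases lt_trichotomy (n + 1) t with hn | hn | hn
    · exact hC (.inr (.inr ⟨n, by omega⟩))
    · rw [hn, R.h_pow_eq hk ht]
      obtain ⟨k, rfl⟩ := Nat.exists_eq_add_of_le' hk
      exact hw k
    · rw [R.h_pow_eq_zero hk ht hn]; exact zero_mem _
  rintro z ⟨p, q, H⟩
  cases H with
  | e1 => exact hC (.inl (.inl ()))
  | e2 => exact hC (.inl (.inr (.inl ())))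
  | u n => exact hu n
  | w n => exact hw n
  | h n => exact hh n
  | ua n =>
    cases n with
    | zero => rw [pow_zero, one_mul]; exact hC (.inl (.inr (.inr ())))
    | succ n => exact hS (R.ua_mem hk ht n)
  | v n => simpa using M.sub_mem (hS (R.u_add_v_mem hk ht h2 n)) (hu n)
  | vbg n =>
    cases n with
    | zero =>
      obtain ⟨t, rfl⟩ := Nat.exists_eq_add_of_le' ht
      have : g * b ∈ M := by rw [R.gb]; exact hh t
      simpa using M.sub_mem (hS bg_add_gb_mem) this
    | succ n => exact hS (R.vbg_mem hk ht n)
  | vb n => exact hS (R.vb_mem hk ht n)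
  | uab n => exact hS (R.uab_mem hk ht n)
  | wg n => exact hS (R.wg_mem hk ht n)
  | wga n => exact hS (R.wga_mem hk ht n)

omit h2 in
theorem mem_of_isPath_of_ne (hgen : Algebra.adjoin F {e1, e2, a, b, g, h} = ⊤) {i j : Bool}
    {x : A} (hx : IsPath (vertex e1 e2 i) (vertex e1 e2 j) x) (hij : i ≠ j) :
    x ∈ commutatorSpan F k a b g := by
  suffices vertex e1 e2 i * x * vertex e1 e2 j ∈ commutatorSpan F k a b g by
    rwa [hx.1, hx.2] at this
  have hx' : x ∈ Submodule.span F {z | ∃ p q, NormalPath e1 e2 a b g h p q z} :=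
    R.span_normalPath hk ht hgen ▸ trivial
  clear hx
  induction hx' using Submodule.span_induction with
  | zero => simp
  | add x y _ _ hx hy => rw [mul_add, add_mul]; exact add_mem hx hy
  | smul r x _ hx => rw [mul_smul_comm, smul_mul_assoc]; exact Submodule.smul_mem _ r hx
  | mem y hy =>
    obtain ⟨p, q, H⟩ := hy
    have hp := R.isPath_normalPath H
    by_cases hip : i = p
    · by_cases hqj : q = j
      · subst hip hqj
        rw [hp.1, hp.2]
        cases H with
        | vb n => exact R.vb_mem hk ht n
        | uab n => exact R.uab_mem hk ht n
        | wg n => exact R.wg_mem hk ht n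
        | wga n => exact R.wga_mem hk ht n
        | _ => exact absurd rfl hij
      · rw [← hp.2, mul_assoc, mul_assoc, R.vertex_mul_of_ne hqj, mul_zero, mul_zero]
        exact zero_mem _
    · rw [← hp.1, ← mul_assoc, R.vertex_mul_of_ne hip, zero_mul, zero_mul]
      exact zero_mem _

theorem commutator_arrow_mem (hgen : Algebra.adjoin F {e1, e2, a, b, g, h} = ⊤)
    {i j p q : Bool} {x y : A} (hx : IsArrow a b g h i j x)
    (hy : NormalPath e1 e2 a b g h p q y) : x * y - y * x ∈ commutatorSpan F k a b g := by
  have px := R.isPath_arrow hx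
  have py := R.isPath_normalPath hy
  have hij : ∀ {i j p q : Bool} {x y : A}, IsPath (vertex e1 e2 i) (vertex e1 e2 j) x →
      IsPath (vertex e1 e2 p) (vertex e1 e2 q) y → ¬ (j = p ∧ i = q) →
      x * y ∈ commutatorSpan F k a b g := by
    intro i j p q x y hx hy hne
    by_cases hjp : j = p
    · subst hjp
      exact R.mem_of_isPath_of_ne hk ht hgen (hx.mul hy) fun h => hne ⟨rfl, h⟩
    · rw [R.mul_normalPath_eq_zero hx hy hjp]; exact zero_mem _
  by_cases hcyc : j = p ∧ i = q
  swap
  · exact sub_mem (hij px py hcyc) (hij py px fun h => hcyc ⟨h.2.symm, h.1.symm⟩)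
  obtain ⟨rfl, rfl⟩ := hcyc
  obtain ⟨s, rfl⟩ := Nat.exists_eq_add_of_le' ht
  have hgb : g * b = h ^ (s + 1) := R.gb
  cases hx with
  | a =>
    cases hy with
    | e1 => rw [R.aR, R.aL, sub_self]; exact zero_mem _
    | u n =>
      rw [pow_succ', ← mul_assoc, ← mul_assoc, ← mul_assoc, R.a_a_b hk ht, zero_mul, zero_mul,
        zero_sub, ← pow_succ']
      exact neg_mem (R.ua_mem hk ht n)
    | ua n =>
      cases n with
      | zero => simp
      | succ n =>
        rw [mul_assoc _ a a, pow_succ _ n, mul_assoc _ _ (a * a), mul_assoc _ g (a * a),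
          R.g_a_a hk ht, ← pow_succ, pow_succ', ← mul_assoc, ← mul_assoc, ← mul_assoc,
          ← mul_assoc, R.a_a_b hk ht]
        simp
    | v n =>
      rw [mul_rotate_pow, R.v_a hk ht, sub_zero]
      exact R.ua_mem hk ht n
    | vbg n =>
      rw [← mul_assoc, mul_rotate_pow, mul_assoc, ← mul_assoc a, ← pow_succ,
        mul_assoc _ (b * g), ← pow_succ, sub_eq_add_of_two_eq_zero h2]
      exact R.u_add_v_mem hk ht h2 n
  | b =>
    cases hy with
    | wg n =>
      cases n with
      | zero =>
        rw [pow_zero, one_mul, sub_eq_add_of_two_eq_zero h2]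
        exact bg_add_gb_mem
      | succ n =>
        rw [← mul_assoc, mul_rotate_pow, mul_assoc, pow_succ (g * a * b), mul_assoc g a b,
          ← mul_assoc _ g, mul_assoc _ (a * b) g, mul_assoc _ (a * b * g) b, R.a_b_g_b hk ht,
          mul_zero, sub_zero]
        exact R.vbg_mem hk ht n
    | wga n =>
      rw [← mul_assoc, mul_rotate_pow, mul_assoc, ← mul_assoc b, ← pow_succ,
        mul_assoc _ (g * a), ← pow_succ, sub_eq_add_of_two_eq_zero h2,
        show (b * g * a) ^ (n + 1) + (g * a * b) ^ (n + 1) =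
          ((a * b * g) ^ (n + 1) + (b * g * a) ^ (n + 1)) -
          ((a * b * g) ^ (n + 1) + (g * a * b) ^ (n + 1)) by
            rw [add_sub_add_left_eq_sub, sub_eq_add_of_two_eq_zero h2]]
      exact sub_mem (R.u_add_v_mem hk ht h2 n) (R.u_add_w_mem hk ht n)
  | g =>
    cases hy with
    | vb n =>
      cases n with
      | zero =>
        rw [pow_zero, one_mul, sub_eq_add_of_two_eq_zero h2, add_comm]
        exact bg_add_gb_mem
      | succ n =>
        rw [mul_assoc _ b g, pow_succ' (b * g * a), ← mul_assoc, ← mul_assoc, ← mul_assoc,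
          ← mul_assoc, R.g_b_g_a hk ht, zero_mul, zero_mul, zero_sub, ← pow_succ']
        exact neg_mem (R.vbg_mem hk ht n)
    | uab n =>
      rw [← mul_assoc, mul_rotate_pow, mul_assoc, ← mul_assoc g, ← pow_succ,
        mul_assoc _ (a * b), ← pow_succ, sub_eq_add_of_two_eq_zero h2, add_comm]
      exact R.u_add_w_mem hk ht n
  | h =>
    cases hy with
    | e2 => rw [R.hR, R.hL, sub_self]; exact zero_mem _
    | w n =>
      rw [R.w_h hk ht, pow_succ', ← mul_assoc, ← mul_assoc, ← mul_assoc, R.h_g_a hk ht]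
      simp
    | h n => rw [← pow_succ', ← pow_succ, sub_self]; exact zero_mem _

theorem commutator_mem (hgen : Algebra.adjoin F {e1, e2, a, b, g, h} = ⊤) (x y : A) :
    x * y - y * x ∈ commutatorSpan F k a b g := by
  have hvertex : ∀ i y, vertex e1 e2 i * y - y * vertex e1 e2 i ∈ commutatorSpan F k a b g := by
    intro i y
    have hv : vertex e1 e2 i + vertex e1 e2 (!i) = 1 := by
      cases i
      · exact R.unit
      · rw [add_comm]; exact R.unit
    have key : ∀ i y, ∀ j, j ≠ i →
        vertex e1 e2 i * y * vertex e1 e2 j ∈ commutatorSpan F k a b g := fun i y j hji =>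
      R.mem_of_isPath_of_ne hk ht hgen
        ⟨by rw [← mul_assoc, ← mul_assoc, R.vertex_mul_self],
          by rw [mul_assoc, R.vertex_mul_self]⟩ hji.symm
    have : vertex e1 e2 i * y - y * vertex e1 e2 i =
        vertex e1 e2 i * y * vertex e1 e2 (!i) - vertex e1 e2 (!i) * y * vertex e1 e2 i := by
      rw [eq_sub_of_add_eq' hv]; noncomm_ring
    rw [this]
    exact sub_mem (key _ _ _ (by simp)) (key _ _ _ (by simp))
  have harrow : ∀ {i j x}, IsArrow a b g h i j x → ∀ y,
      x * y - y * x ∈ commutatorSpan F k a b g := by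
    intro i j x hx y
    have hy : y ∈ Submodule.span F {z | ∃ p q, NormalPath e1 e2 a b g h p q z} :=
      R.span_normalPath hk ht hgen ▸ trivial
    induction hy using Submodule.span_induction with
    | zero => simp
    | add y z _ _ hy hz =>
      rw [mul_add, add_mul, add_sub_add_comm]; exact add_mem hy hz
    | smul r y _ hy =>
      rw [mul_smul_comm, smul_mul_assoc, ← smul_sub]; exact Submodule.smul_mem _ r hy
    | mem y hy =>
      obtain ⟨p, q, H⟩ := hy
      exact R.commutator_arrow_mem hk ht h2 hgen hx H
  have hx : x ∈ Algebra.adjoin F {e1, e2, a, b, g, h} := hgen ▸ trivial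
  revert y
  induction hx using Algebra.adjoin_induction with
  | mem x hx =>
    rcases hx with rfl | rfl | rfl | rfl | rfl | rfl
    exacts [hvertex false, hvertex true, harrow .a, harrow .b, harrow .g, harrow .h]
  | algebraMap r => intro y; rw [Algebra.commutes, sub_self]; exact zero_mem _
  | add x y _ _ hx hy =>
    intro z
    rw [mul_add, add_mul, add_sub_add_comm]; exact add_mem (hx z) (hy z)
  | mul x y _ _ hx hy =>
    intro z
    have : x * y * z - z * (x * y) = (x * (y * z) - y * z * x) + (y * (z * x) - z * x * y) := by
      noncomm_ring
    rw [this]; exact add_mem (hx _) (hy _)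

theorem commutatorSpan_eq (hgen : Algebra.adjoin F {e1, e2, a, b, g, h} = ⊤) :
    commutatorSpan F k a b g = Kspan F A := by
  refine le_antisymm (Submodule.span_le.2 ?_) (Submodule.span_le.2 ?_)
  swap
  · rintro _ ⟨x, y, rfl⟩
    exact R.commutator_mem hk ht h2 hgen x y
  have hcomm : ∀ x y : A, x * y + y * x ∈ Kspan F A := fun x y => by
    rw [← sub_eq_add_of_two_eq_zero h2]; exact Submodule.subset_span ⟨x, y, rfl⟩
  have hpath : ∀ {i j x}, IsPath (vertex e1 e2 i) (vertex e1 e2 j) x → i ≠ j →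
      x ∈ Kspan F A := fun {i j x} hx hij => by
    have := hcomm (vertex e1 e2 i) x
    rwa [hx.1, ← hx.2, mul_assoc, R.vertex_mul_of_ne hij.symm, mul_zero, add_zero, hx.2] at this
  rintro _ ⟨i, rfl⟩
  rcases i with (n | n | n | n) | (_ | n | n | n) | n
  · exact hpath (R.isPath_normalPath (.vb n)) (by simp)
  · exact hpath (R.isPath_normalPath (.uab n)) (by simp)
  · exact hpath (R.isPath_normalPath (.wg n)) (by simp)
  · exact hpath (R.isPath_normalPath (.wga n)) (by simp)
  · exact hcomm b g
  · convert hcomm a ((b * g * a) ^ n.1 * (b * g)) using 1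
    rw [← mul_assoc, mul_rotate_pow, mul_assoc, mul_assoc _ (b * g) a, ← pow_succ,
      ← mul_assoc a b g, ← pow_succ]
    rfl
  · convert hcomm a ((b * g * a) ^ (n.1 + 1)) using 1
    rw [mul_rotate_pow, R.v_a hk ht, add_zero]
    rfl
  · convert hcomm b ((g * a * b) ^ (n.1 + 1) * g) using 1
    rw [← mul_assoc, mul_rotate_pow, mul_assoc, pow_succ (g * a * b), mul_assoc g a b,
      ← mul_assoc _ g, mul_assoc _ (a * b) g, mul_assoc _ (a * b * g) b, R.a_b_g_b hk ht,
      mul_zero, add_zero]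
    rfl
  · convert hcomm ((a * b * g) ^ n.1 * (a * b)) g using 1
    rw [← mul_assoc g, mul_rotate_pow, mul_assoc _ (a * b), ← pow_succ, mul_assoc _ g (a * b),
      ← mul_assoc g a b, ← pow_succ]
    rfl

end

end SDRels
end Paths

section RegularModule

/-- Names for the elements of the path basis: the two trivial paths, the two socle elements, the
proper initial subpaths of length `l` of the cycles through `α`, `β`, `γ`, and the powers of
`η`. -/
inductive Label : Type
  | e1 | e2 | s1 | s2
  | wa (l : ℕ) | wb (l : ℕ) | wg (l : ℕ)
  | h (l : ℕ)
  deriving DecidableEq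

/-- The labels of actual basis elements. -/
def labels (k t : ℕ) : Finset Label :=
  {.e1, .e2, .s1, .s2} ∪ ((Finset.Ico 1 (3 * k)).image .wa ∪ ((Finset.Ico 1 (3 * k)).image .wb ∪
    ((Finset.Ico 1 (3 * k)).image .wg ∪ (Finset.Ico 1 t).image .h)))

theorem card_labels (hk : 1 ≤ k) (ht : 1 ≤ t) : (labels k t).card = 9 * k + t := by
  rw [labels, Finset.card_union_of_disjoint, Finset.card_union_of_disjoint,
    Finset.card_union_of_disjoint, Finset.card_union_of_disjoint,
    Finset.card_image_of_injective, Finset.card_image_of_injective,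
    Finset.card_image_of_injective, Finset.card_image_of_injective]
  · simp
    omega
  any_goals
    intro x y hxy
    simpa using hxy
  all_goals
    rw [Finset.disjoint_left]
    simp
  all_goals aesop

/-- The vector space underlying the regular module. -/
abbrev RegModule : Type := labels k t →₀ F

variable {F k t c}

/-- The basis vector of a label, zero for the meaningless labels. -/
def basisVec (r : Label) : RegModule F k t :=
  if hr : r ∈ labels k t then Finsupp.single ⟨r, hr⟩ 1 else 0

/-- The operator with given values on the basis vectors. -/
def operator (f : Label → RegModule F k t) : Module.End F (RegModule F k t) :=
  Finsupp.linearCombination F fun r : labels k t => f r.1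

theorem operator_basisVec (f : Label → RegModule F k t) (r : Label) :
    operator f (basisVec r) = if r ∈ labels k t then f r else 0 := by
  unfold basisVec
  split_ifs with hr
  · simp [operator]
  · simp

/-- The vectors of the cycle through `α` at the first vertex, by length. -/
def vecA (l : ℕ) : RegModule F k t :=
  if l = 0 then basisVec .e1 else if l = 3 * k then basisVec .s1 else basisVec (.wa l)

/-- The vectors of the cycle through `β`, by length. -/
def vecB (l : ℕ) : RegModule F k t :=
  if l = 0 then basisVec .e1 else if l = 3 * k then basisVec .s1 else basisVec (.wb l)

/-- The vectors of the cycle through `γ`, by length. -/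
def vecG (l : ℕ) : RegModule F k t :=
  if l = 0 then basisVec .e2 else if l = 3 * k then basisVec .s2 else basisVec (.wg l)

/-- The vectors of the powers of `η`. -/
def vecH (l : ℕ) : RegModule F k t :=
  if l = 0 then basisVec .e2 else if l = t then basisVec .s2 else basisVec (.h l)

/-- The action of the idempotent at the first vertex. -/
def opE1 : Module.End F (RegModule F k t) := operator fun
  | .e1 => basisVec .e1
  | .s1 => basisVec .s1
  | .wa l => basisVec (.wa l)
  | .wb l => basisVec (.wb l)
  | _ => 0

/-- The action of the idempotent at the second vertex. -/
def opE2 : Module.End F (RegModule F k t) := operator fun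
  | .e2 => basisVec .e2
  | .s2 => basisVec .s2
  | .wg l => basisVec (.wg l)
  | .h l => basisVec (.h l)
  | _ => 0

/-- The action of `α`. -/
def opA (c : F) : Module.End F (RegModule F k t) := operator fun
  | .e1 => vecA 1
  | .wa l => if l = 1 then c • basisVec .s1 else 0
  | .wb l => vecA (l + 1)
  | _ => 0

/-- The action of `β`. -/
def opB : Module.End F (RegModule F k t) := operator fun
  | .e2 => vecB 1
  | .wg l => vecB (l + 1)
  | .h l => if l = 1 then vecA (3 * k - 1) else 0
  | _ => 0

/-- The action of `γ`. -/
def opG : Module.End F (RegModule F k t) := operator fun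
  | .e1 => vecG 1
  | .wa l => vecG (l + 1)
  | .wb l => if l = 1 then vecH (t - 1) else if l = 2 ∧ t = 2 then vecG (3 * k - 1) else 0
  | _ => 0

/-- The action of `η`. -/
def opH : Module.End F (RegModule F k t) := operator fun
  | .e2 => vecH 1
  | .wg l => if l = 1 then vecG (3 * k - 1) else 0
  | .h l => vecH (l + 1)
  | _ => 0

section Labels

variable {r : Label} {l : ℕ}

theorem e1_mem : Label.e1 ∈ labels k t := by simp [labels]
theorem e2_mem : Label.e2 ∈ labels k t := by simp [labels]
theorem s1_mem : Label.s1 ∈ labels k t := by simp [labels]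
theorem s2_mem : Label.s2 ∈ labels k t := by simp [labels]
theorem wa_mem : Label.wa l ∈ labels k t ↔ 1 ≤ l ∧ l < 3 * k := by simp [labels]
theorem wb_mem : Label.wb l ∈ labels k t ↔ 1 ≤ l ∧ l < 3 * k := by simp [labels]
theorem wg_mem : Label.wg l ∈ labels k t ↔ 1 ≤ l ∧ l < 3 * k := by simp [labels]
theorem h_mem : Label.h l ∈ labels k t ↔ 1 ≤ l ∧ l < t := by simp [labels]

theorem basisVec_of_notMem (hr : r ∉ labels k t) : (basisVec r : RegModule F k t) = 0 := dif_neg hr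

theorem vecA_eq_zero (hl : 3 * k < l) : (vecA l : RegModule F k t) = 0 := by
  rw [vecA, if_neg (by omega), if_neg (by omega), basisVec_of_notMem (by rw [wa_mem]; omega)]
theorem vecB_eq_zero (hl : 3 * k < l) : (vecB l : RegModule F k t) = 0 := by
  rw [vecB, if_neg (by omega), if_neg (by omega), basisVec_of_notMem (by rw [wb_mem]; omega)]
theorem vecG_eq_zero (hl : 3 * k < l) : (vecG l : RegModule F k t) = 0 := by
  rw [vecG, if_neg (by omega), if_neg (by omega), basisVec_of_notMem (by rw [wg_mem]; omega)]
theorem vecH_eq_zero (hl : t < l) : (vecH l : RegModule F k t) = 0 := by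
  rw [vecH, if_neg (by omega), if_neg (by omega), basisVec_of_notMem (by rw [h_mem]; omega)]

theorem vecB_zero : (vecB 0 : RegModule F k t) = vecA 0 := by simp [vecA, vecB]
theorem vecH_zero : (vecH 0 : RegModule F k t) = vecG 0 := by simp [vecG, vecH]
theorem vecB_top : (vecB (3 * k) : RegModule F k t) = vecA (3 * k) := by
  simp [vecA, vecB]
theorem vecH_top (hk : 1 ≤ k) (ht : 2 ≤ t) : (vecH t : RegModule F k t) = vecG (3 * k) := by
  simp [vecG, vecH, show k ≠ 0 by omega, show t ≠ 0 by omega]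

end Labels

theorem eq_top_of_vec_mem {p : Submodule F (RegModule F k t)} (hk : 1 ≤ k)
    (hA : ∀ l, vecA l ∈ p) (hB : ∀ l, vecB (l + 1) ∈ p) (hG : ∀ l, vecG l ∈ p)
    (hH : ∀ l, vecH (l + 1) ∈ p) : p = ⊤ := by
  have key : ∀ r ∈ labels k t, basisVec r ∈ p := by
    intro r hr
    cases r with
    | e1 => simpa [vecA] using hA 0
    | e2 => simpa [vecG] using hG 0
    | s1 => simpa [vecA, show k ≠ 0 by omega] using hA (3 * k)
    | s2 => simpa [vecG, show k ≠ 0 by omega] using hG (3 * k)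
    | wa l =>
      rw [wa_mem] at hr
      simpa [vecA, show l ≠ 0 by omega, hr.2.ne] using hA l
    | wb l =>
      rw [wb_mem] at hr
      obtain ⟨l, rfl⟩ := Nat.exists_eq_add_of_le' hr.1
      simpa [vecB, hr.2.ne] using hB l
    | wg l =>
      rw [wg_mem] at hr
      simpa [vecG, show l ≠ 0 by omega, hr.2.ne] using hG l
    | h l =>
      rw [h_mem] at hr
      obtain ⟨l, rfl⟩ := Nat.exists_eq_add_of_le' hr.1
      simpa [vecH, hr.2.ne] using hH l
  refine eq_top_iff.2 fun v _ => ?_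
  induction v using Finsupp.induction_linear with
  | zero => exact p.zero_mem
  | add v w hv hw => exact p.add_mem (hv trivial) (hw trivial)
  | single r x =>
    have := p.smul_mem x (key r.1 r.2)
    simpa [basisVec] using this

theorem linearMap_ext {M : Type} [AddCommGroup M] [Module F M] {S T : RegModule F k t →ₗ[F] M}
    (hk : 1 ≤ k) (hA : ∀ l, S (vecA l) = T (vecA l))
    (hB : ∀ l, S (vecB (l + 1)) = T (vecB (l + 1))) (hG : ∀ l, S (vecG l) = T (vecG l))
    (hH : ∀ l, S (vecH (l + 1)) = T (vecH (l + 1))) : S = T :=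
  LinearMap.eqLocus_eq_top.1 (eq_top_of_vec_mem hk hA hB hG hH)

theorem opA_vecB (hk : 1 ≤ k) (l : ℕ) :
    opA c (vecB l : RegModule F k t) = vecA (l + 1) := by
  grind [operator_basisVec, opA, vecB, e1_mem, e2_mem, s1_mem, s2_mem, wa_mem, wb_mem,
    wg_mem, h_mem, vecA_eq_zero, vecB_eq_zero, vecG_eq_zero, vecH_eq_zero]

theorem opA_vecA_one (hk : 1 ≤ k) :
    opA c (vecA 1 : RegModule F k t) = c • vecA (3 * k) := by
  grind [operator_basisVec, opA, vecA, e1_mem, e2_mem, s1_mem, s2_mem, wa_mem, wb_mem,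
    wg_mem, h_mem, vecA_eq_zero, vecB_eq_zero, vecG_eq_zero, vecH_eq_zero]

theorem opA_vecA_add_two (l : ℕ) :
    opA c (vecA (l + 2) : RegModule F k t) = 0 := by
  grind [operator_basisVec, opA, vecA, e1_mem, e2_mem, s1_mem, s2_mem, wa_mem, wb_mem,
    wg_mem, h_mem, vecA_eq_zero, vecB_eq_zero, vecG_eq_zero, vecH_eq_zero]

theorem opA_vecG (l : ℕ) :
    opA c (vecG l : RegModule F k t) = 0 := by
  grind [operator_basisVec, opA, vecG, e1_mem, e2_mem, s1_mem, s2_mem, wa_mem, wb_mem,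
    wg_mem, h_mem, vecA_eq_zero, vecB_eq_zero, vecG_eq_zero, vecH_eq_zero]

theorem opA_vecH (l : ℕ) :
    opA c (vecH l : RegModule F k t) = 0 := by
  grind [operator_basisVec, opA, vecH, e1_mem, e2_mem, s1_mem, s2_mem, wa_mem, wb_mem,
    wg_mem, h_mem, vecA_eq_zero, vecB_eq_zero, vecG_eq_zero, vecH_eq_zero]

theorem opB_vecG (hk : 1 ≤ k) (l : ℕ) :
    opB (vecG l : RegModule F k t) = vecB (l + 1) := by
  grind [operator_basisVec, opB, vecG, e1_mem, e2_mem, s1_mem, s2_mem, wa_mem, wb_mem,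
    wg_mem, h_mem, vecA_eq_zero, vecB_eq_zero, vecG_eq_zero, vecH_eq_zero]

theorem opB_vecA (l : ℕ) :
    opB (vecA l : RegModule F k t) = 0 := by
  grind [operator_basisVec, opB, vecA, e1_mem, e2_mem, s1_mem, s2_mem, wa_mem, wb_mem,
    wg_mem, h_mem, vecA_eq_zero, vecB_eq_zero, vecG_eq_zero, vecH_eq_zero]

theorem opB_vecB (l : ℕ) :
    opB (vecB l : RegModule F k t) = 0 := by
  grind [operator_basisVec, opB, vecB, e1_mem, e2_mem, s1_mem, s2_mem, wa_mem, wb_mem,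
    wg_mem, h_mem, vecA_eq_zero, vecB_eq_zero, vecG_eq_zero, vecH_eq_zero]

theorem opB_vecH_one (ht : 2 ≤ t) :
    opB (vecH 1 : RegModule F k t) = vecA (3 * k - 1) := by
  grind [operator_basisVec, opB, vecH, e1_mem, e2_mem, s1_mem, s2_mem, wa_mem, wb_mem,
    wg_mem, h_mem, vecA_eq_zero, vecB_eq_zero, vecG_eq_zero, vecH_eq_zero]

theorem opB_vecH_add_two (l : ℕ) :
    opB (vecH (l + 2) : RegModule F k t) = 0 := by
  grind [operator_basisVec, opB, vecH, e1_mem, e2_mem, s1_mem, s2_mem, wa_mem, wb_mem,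
    wg_mem, h_mem, vecA_eq_zero, vecB_eq_zero, vecG_eq_zero, vecH_eq_zero]

theorem opG_vecA (l : ℕ) :
    opG (vecA l : RegModule F k t) = vecG (l + 1) := by
  grind [operator_basisVec, opG, vecA, e1_mem, e2_mem, s1_mem, s2_mem, wa_mem, wb_mem,
    wg_mem, h_mem, vecA_eq_zero, vecB_eq_zero, vecG_eq_zero, vecH_eq_zero]

theorem opG_vecG (l : ℕ) :
    opG (vecG l : RegModule F k t) = 0 := by
  grind [operator_basisVec, opG, vecG, e1_mem, e2_mem, s1_mem, s2_mem, wa_mem, wb_mem,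
    wg_mem, h_mem, vecA_eq_zero, vecB_eq_zero, vecG_eq_zero, vecH_eq_zero]

theorem opG_vecH (l : ℕ) :
    opG (vecH l : RegModule F k t) = 0 := by
  grind [operator_basisVec, opG, vecH, e1_mem, e2_mem, s1_mem, s2_mem, wa_mem, wb_mem,
    wg_mem, h_mem, vecA_eq_zero, vecB_eq_zero, vecG_eq_zero, vecH_eq_zero]

theorem opG_vecB_one (hk : 1 ≤ k) :
    opG (vecB 1 : RegModule F k t) = vecH (t - 1) := by
  grind [operator_basisVec, opG, vecB, e1_mem, e2_mem, s1_mem, s2_mem, wa_mem, wb_mem,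
    wg_mem, h_mem, vecA_eq_zero, vecB_eq_zero, vecG_eq_zero, vecH_eq_zero]

theorem opG_vecB_two (hk : 1 ≤ k) :
    opG (vecB 2 : RegModule F k t) = if t = 2 then vecG (3 * k - 1) else 0 := by
  grind [operator_basisVec, opG, vecB, e1_mem, e2_mem, s1_mem, s2_mem, wa_mem, wb_mem,
    wg_mem, h_mem, vecA_eq_zero, vecB_eq_zero, vecG_eq_zero, vecH_eq_zero]

theorem opG_vecB_add_three (l : ℕ) :
    opG (vecB (l + 3) : RegModule F k t) = 0 := by
  grind [operator_basisVec, opG, vecB, e1_mem, e2_mem, s1_mem, s2_mem, wa_mem, wb_mem,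
    wg_mem, h_mem, vecA_eq_zero, vecB_eq_zero, vecG_eq_zero, vecH_eq_zero]

theorem opH_vecA (l : ℕ) :
    opH (vecA l : RegModule F k t) = 0 := by
  grind [operator_basisVec, opH, vecA, e1_mem, e2_mem, s1_mem, s2_mem, wa_mem, wb_mem,
    wg_mem, h_mem, vecA_eq_zero, vecB_eq_zero, vecG_eq_zero, vecH_eq_zero]

theorem opH_vecB (l : ℕ) :
    opH (vecB l : RegModule F k t) = 0 := by
  grind [operator_basisVec, opH, vecB, e1_mem, e2_mem, s1_mem, s2_mem, wa_mem, wb_mem,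
    wg_mem, h_mem, vecA_eq_zero, vecB_eq_zero, vecG_eq_zero, vecH_eq_zero]

theorem opH_vecH (ht : 2 ≤ t) (l : ℕ) :
    opH (vecH l : RegModule F k t) = vecH (l + 1) := by
  grind [operator_basisVec, opH, vecH, e1_mem, e2_mem, s1_mem, s2_mem, wa_mem, wb_mem,
    wg_mem, h_mem, vecA_eq_zero, vecB_eq_zero, vecG_eq_zero, vecH_eq_zero]

theorem opH_vecG_one (hk : 1 ≤ k) :
    opH (vecG 1 : RegModule F k t) = vecG (3 * k - 1) := by
  grind [operator_basisVec, opH, vecG, e1_mem, e2_mem, s1_mem, s2_mem, wa_mem, wb_mem,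
    wg_mem, h_mem, vecA_eq_zero, vecB_eq_zero, vecG_eq_zero, vecH_eq_zero]

theorem opH_vecG_add_two (l : ℕ) :
    opH (vecG (l + 2) : RegModule F k t) = 0 := by
  grind [operator_basisVec, opH, vecG, e1_mem, e2_mem, s1_mem, s2_mem, wa_mem, wb_mem,
    wg_mem, h_mem, vecA_eq_zero, vecB_eq_zero, vecG_eq_zero, vecH_eq_zero]

theorem opE1_vecA (l : ℕ) :
    opE1 (vecA l : RegModule F k t) = vecA l := by
  grind [operator_basisVec, opE1, vecA, e1_mem, e2_mem, s1_mem, s2_mem, wa_mem, wb_mem,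
    wg_mem, h_mem, vecA_eq_zero, vecB_eq_zero, vecG_eq_zero, vecH_eq_zero]

theorem opE1_vecB (l : ℕ) :
    opE1 (vecB l : RegModule F k t) = vecB l := by
  grind [operator_basisVec, opE1, vecB, e1_mem, e2_mem, s1_mem, s2_mem, wa_mem, wb_mem,
    wg_mem, h_mem, vecA_eq_zero, vecB_eq_zero, vecG_eq_zero, vecH_eq_zero]

theorem opE1_vecG (l : ℕ) :
    opE1 (vecG l : RegModule F k t) = 0 := by
  grind [operator_basisVec, opE1, vecG, e1_mem, e2_mem, s1_mem, s2_mem, wa_mem, wb_mem,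
    wg_mem, h_mem, vecA_eq_zero, vecB_eq_zero, vecG_eq_zero, vecH_eq_zero]

theorem opE1_vecH (l : ℕ) :
    opE1 (vecH l : RegModule F k t) = 0 := by
  grind [operator_basisVec, opE1, vecH, e1_mem, e2_mem, s1_mem, s2_mem, wa_mem, wb_mem,
    wg_mem, h_mem, vecA_eq_zero, vecB_eq_zero, vecG_eq_zero, vecH_eq_zero]

theorem opE2_vecG (l : ℕ) :
    opE2 (vecG l : RegModule F k t) = vecG l := by
  grind [operator_basisVec, opE2, vecG, e1_mem, e2_mem, s1_mem, s2_mem, wa_mem, wb_mem,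
    wg_mem, h_mem, vecA_eq_zero, vecB_eq_zero, vecG_eq_zero, vecH_eq_zero]

theorem opE2_vecH (l : ℕ) :
    opE2 (vecH l : RegModule F k t) = vecH l := by
  grind [operator_basisVec, opE2, vecH, e1_mem, e2_mem, s1_mem, s2_mem, wa_mem, wb_mem,
    wg_mem, h_mem, vecA_eq_zero, vecB_eq_zero, vecG_eq_zero, vecH_eq_zero]

theorem opE2_vecA (l : ℕ) :
    opE2 (vecA l : RegModule F k t) = 0 := by
  grind [operator_basisVec, opE2, vecA, e1_mem, e2_mem, s1_mem, s2_mem, wa_mem, wb_mem,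
    wg_mem, h_mem, vecA_eq_zero, vecB_eq_zero, vecG_eq_zero, vecH_eq_zero]

theorem opE2_vecB (l : ℕ) :
    opE2 (vecB l : RegModule F k t) = 0 := by
  grind [operator_basisVec, opE2, vecB, e1_mem, e2_mem, s1_mem, s2_mem, wa_mem, wb_mem,
    wg_mem, h_mem, vecA_eq_zero, vecB_eq_zero, vecG_eq_zero, vecH_eq_zero]

theorem opABG_pow_vecA (hk : 1 ≤ k) (m l : ℕ) :
    ((opA c * opB * opG : Module.End F (RegModule F k t)) ^ m) (vecA l) = vecA (l + 3 * m) := by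
  induction m generalizing l with
  | zero => rfl
  | succ m ih =>
    rw [pow_succ, Module.End.mul_apply, Module.End.mul_apply, Module.End.mul_apply,
      opG_vecA, opB_vecG hk, opA_vecB hk, ih]
    congr 1; omega

theorem opBGA_pow_vecB (hk : 1 ≤ k) (m l : ℕ) :
    ((opB * opG * opA c : Module.End F (RegModule F k t)) ^ m) (vecB l) = vecB (l + 3 * m) := by
  induction m generalizing l with
  | zero => rfl
  | succ m ih =>
    rw [pow_succ, Module.End.mul_apply, Module.End.mul_apply, Module.End.mul_apply,
      opA_vecB hk, opG_vecA, opB_vecG hk, ih]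
    congr 1; omega

theorem opGAB_pow_vecG (hk : 1 ≤ k) (m l : ℕ) :
    ((opG * opA c * opB : Module.End F (RegModule F k t)) ^ m) (vecG l) = vecG (l + 3 * m) := by
  induction m generalizing l with
  | zero => rfl
  | succ m ih =>
    rw [pow_succ, Module.End.mul_apply, Module.End.mul_apply, Module.End.mul_apply,
      opB_vecG hk, opA_vecB hk, opG_vecA, ih]
    congr 1; omega

theorem opH_pow_vecH (ht : 2 ≤ t) (m l : ℕ) :
    ((opH : Module.End F (RegModule F k t)) ^ m) (vecH l) = vecH (l + m) := by
  induction m generalizing l with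
  | zero => rfl
  | succ m ih =>
    rw [pow_succ, Module.End.mul_apply, opH_vecH ht, ih]
    congr 1; omega

theorem opH_vecG_eq_zero {l : ℕ} (hl : 2 ≤ l) : opH (vecG l : RegModule F k t) = 0 := by
  obtain ⟨l, rfl⟩ := Nat.exists_eq_add_of_le' hl
  exact opH_vecG_add_two l

theorem opA_vecA_eq_zero {l : ℕ} (hl : 2 ≤ l) : opA c (vecA l : RegModule F k t) = 0 := by
  obtain ⟨l, rfl⟩ := Nat.exists_eq_add_of_le' hl
  exact opA_vecA_add_two l

theorem opH_opG_vecB (hk : 1 ≤ k) (ht : 2 ≤ t) (l : ℕ) :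
    opH (opG (vecB (l + 1) : RegModule F k t)) = if l = 0 then vecG (3 * k) else 0 := by
  rcases l with _ | _ | l
  · rw [opG_vecB_one hk, opH_vecH ht, Nat.sub_add_cancel (by omega), vecH_top hk ht, if_pos rfl]
  · rw [opG_vecB_two hk, if_neg (show ¬0 + 1 = 0 by omega)]
    split_ifs with h2
    · exact opH_vecG_eq_zero (by omega)
    · exact map_zero _
  · rw [opG_vecB_add_three, map_zero, if_neg (by omega)]

theorem op_unit (hk : 1 ≤ k) :
    (opE1 + opE2 : Module.End F (RegModule F k t)) = 1 := by
  refine linearMap_ext hk ?_ ?_ ?_ ?_ <;> intro l <;>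
    simp [opE1_vecA, opE1_vecB, opE1_vecG, opE1_vecH, opE2_vecA, opE2_vecB, opE2_vecG,
      opE2_vecH]

theorem op_idem1 (hk : 1 ≤ k) :
    (opE1 * opE1 : Module.End F (RegModule F k t)) = opE1 := by
  refine linearMap_ext hk ?_ ?_ ?_ ?_ <;> intro l <;>
    simp [opE1_vecA, opE1_vecB, opE1_vecG, opE1_vecH]

theorem op_idem2 (hk : 1 ≤ k) :
    (opE2 * opE2 : Module.End F (RegModule F k t)) = opE2 := by
  refine linearMap_ext hk ?_ ?_ ?_ ?_ <;> intro l <;>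
    simp [opE2_vecA, opE2_vecB, opE2_vecG, opE2_vecH]

theorem op_orth12 (hk : 1 ≤ k) :
    (opE1 * opE2 : Module.End F (RegModule F k t)) = 0 := by
  refine linearMap_ext hk ?_ ?_ ?_ ?_ <;> intro l <;>
    simp [opE1_vecG, opE1_vecH, opE2_vecA, opE2_vecB, opE2_vecG, opE2_vecH]

theorem op_orth21 (hk : 1 ≤ k) :
    (opE2 * opE1 : Module.End F (RegModule F k t)) = 0 := by
  refine linearMap_ext hk ?_ ?_ ?_ ?_ <;> intro l <;>
    simp [opE1_vecA, opE1_vecB, opE1_vecG, opE1_vecH, opE2_vecA, opE2_vecB]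

theorem op_aL (hk : 1 ≤ k) :
    (opE1 * opA c : Module.End F (RegModule F k t)) = opA c := by
  refine linearMap_ext hk ?_ ?_ ?_ ?_ <;> intro l
  · rcases l with _ | _ | l
    · simp [← vecB_zero, opA_vecB hk, opE1_vecA]
    · simp [opA_vecA_one hk, opE1_vecA]
    · simp [opA_vecA_add_two]
  all_goals simp [opA_vecB hk, opA_vecG, opA_vecH, opE1_vecA]

theorem op_aR (hk : 1 ≤ k) :
    (opA c * opE1 : Module.End F (RegModule F k t)) = opA c := by
  refine linearMap_ext hk ?_ ?_ ?_ ?_ <;> intro l <;>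
    simp [opE1_vecA, opE1_vecB, opE1_vecG, opE1_vecH, opA_vecG, opA_vecH]

theorem op_bL (hk : 1 ≤ k) (ht : 2 ≤ t) :
    (opE1 * opB : Module.End F (RegModule F k t)) = opB := by
  refine linearMap_ext hk ?_ ?_ ?_ ?_ <;> intro l
  rotate_right
  · rcases l with _ | l
    · simp [opB_vecH_one ht, opE1_vecA]
    · simp [opB_vecH_add_two]
  all_goals simp [opB_vecA, opB_vecB, opB_vecG hk, opE1_vecB]

theorem op_bR (hk : 1 ≤ k) :
    (opB * opE2 : Module.End F (RegModule F k t)) = opB := by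
  refine linearMap_ext hk ?_ ?_ ?_ ?_ <;> intro l <;>
    simp [opE2_vecA, opE2_vecB, opE2_vecG, opE2_vecH, opB_vecA, opB_vecB]

theorem op_gL (hk : 1 ≤ k) :
    (opE2 * opG : Module.End F (RegModule F k t)) = opG := by
  refine linearMap_ext hk ?_ ?_ ?_ ?_ <;> intro l
  rotate_left
  · rcases l with _ | _ | l
    · simp [opG_vecB_one hk, opE2_vecH]
    · simp only [zero_add, Nat.reduceAdd, opG_vecB_two hk, Module.End.mul_apply]
      split_ifs <;> simp [opE2_vecG]
    · simp [opG_vecB_add_three]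
  all_goals simp [opG_vecA, opG_vecG, opG_vecH, opE2_vecG]

theorem op_gR (hk : 1 ≤ k) :
    (opG * opE1 : Module.End F (RegModule F k t)) = opG := by
  refine linearMap_ext hk ?_ ?_ ?_ ?_ <;> intro l <;>
    simp [opE1_vecA, opE1_vecB, opE1_vecG, opE1_vecH, opG_vecG, opG_vecH]

theorem op_hL (hk : 1 ≤ k) (ht : 2 ≤ t) :
    (opE2 * opH : Module.End F (RegModule F k t)) = opH := by
  refine linearMap_ext hk ?_ ?_ ?_ ?_ <;> intro l
  rotate_left
  rotate_left
  · rcases l with _ | _ | l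
    · simp [← vecH_zero, opH_vecH ht, opE2_vecH]
    · simp [opH_vecG_one hk, opE2_vecG]
    · simp [opH_vecG_add_two]
  all_goals simp [opH_vecA, opH_vecB, opH_vecH ht, opE2_vecH]

theorem op_hR (hk : 1 ≤ k) :
    (opH * opE2 : Module.End F (RegModule F k t)) = opH := by
  refine linearMap_ext hk ?_ ?_ ?_ ?_ <;> intro l <;>
    simp [opE2_vecA, opE2_vecB, opE2_vecG, opE2_vecH, opH_vecA, opH_vecB]

theorem op_bh (hk : 1 ≤ k) (ht : 2 ≤ t) :
    (opB * opH : Module.End F (RegModule F k t)) = (opA c * opB * opG) ^ (k - 1) * (opA c * opB) := by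
  refine linearMap_ext hk ?_ ?_ ?_ ?_ <;> intro l <;> simp only [Module.End.mul_apply]
  · simp [opH_vecA, opB_vecA]
  · simp [opH_vecB, opB_vecB]
  · rw [opB_vecG hk, opA_vecB hk, opABG_pow_vecA hk]
    rcases l with _ | _ | l
    · rw [← vecH_zero, opH_vecH ht, opB_vecH_one ht]; congr 1; omega
    · rw [opH_vecG_one hk, opB_vecG hk, show 3 * k - 1 + 1 = 3 * k by omega, vecB_top]
      congr 1; omega
    · rw [opH_vecG_add_two, map_zero, vecA_eq_zero (by omega)]
  · rw [opH_vecH ht, opB_vecH_add_two]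
    rcases l with _ | l
    · rw [opB_vecH_one ht, opA_vecA_eq_zero (by omega), map_zero]
    · rw [opB_vecH_add_two, map_zero, map_zero]

theorem op_gb (hk : 1 ≤ k) (ht : 2 ≤ t) :
    (opG * opB : Module.End F (RegModule F k t)) = opH ^ (t - 1) := by
  obtain ⟨s, rfl⟩ := Nat.exists_eq_add_of_le' ht
  refine linearMap_ext hk ?_ ?_ ?_ ?_ <;> intro l <;>
    simp only [Nat.add_succ_sub_one, pow_succ opH, Module.End.mul_apply]
  · simp [opH_vecA, opB_vecA]
  · simp [opH_vecB, opB_vecB]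
  · rw [opB_vecG hk]
    rcases l with _ | _ | l
    · rw [← vecH_zero, opH_vecH ht, opH_pow_vecH ht, zero_add, opG_vecB_one hk]; congr 1; omega
    · rw [opH_vecG_one hk, opG_vecB_two hk]
      rcases s with _ | s
      · simp
      · rw [pow_succ, Module.End.mul_apply, opH_vecG_eq_zero (by omega)]; simp
    · rw [opG_vecB_add_three, opH_vecG_add_two, map_zero]
  · rw [opH_vecH ht, opH_pow_vecH ht]
    rcases l with _ | l
    · rw [opB_vecH_one ht, opG_vecA, show 3 * k - 1 + 1 = 3 * k by omega, ← vecH_top hk ht]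
      congr 1; omega
    · rw [opB_vecH_add_two, map_zero, vecH_eq_zero (by omega)]

theorem op_hg (hk : 1 ≤ k) (ht : 2 ≤ t) :
    (opH * opG : Module.End F (RegModule F k t)) = (opG * opA c * opB) ^ (k - 1) * (opG * opA c) := by
  refine linearMap_ext hk ?_ ?_ ?_ ?_ <;> intro l <;> simp only [Module.End.mul_apply]
  · rw [opG_vecA]
    rcases l with _ | _ | l
    · rw [← vecB_zero, opA_vecB hk, opG_vecA, opGAB_pow_vecG hk, opH_vecG_one hk]
      congr 1; omega
    · rw [opH_vecG_add_two, zero_add, opA_vecA_one hk, map_smul, opG_vecA, map_smul,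
        opGAB_pow_vecG hk, vecG_eq_zero (by omega), smul_zero]
    · rw [opH_vecG_add_two, opA_vecA_add_two, map_zero, map_zero]
  · rw [opH_opG_vecB hk ht, opA_vecB hk, opG_vecA, opGAB_pow_vecG hk]
    split_ifs with h0
    · congr 1; omega
    · rw [vecG_eq_zero (by omega)]
  · simp [opG_vecG, opA_vecG]
  · simp [opG_vecH, opA_vecH]

theorem op_bh2 (hk : 1 ≤ k) (ht : 2 ≤ t) :
    (opB * opH * opH : Module.End F (RegModule F k t)) = 0 := by
  refine linearMap_ext hk ?_ ?_ ?_ ?_ <;> intro l <;> simp only [Module.End.mul_apply]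
  · simp [opH_vecA]
  · simp [opH_vecB]
  · rcases l with _ | _ | l
    · rw [← vecH_zero, opH_vecH ht, opH_vecH ht, opB_vecH_add_two]; rfl
    · rw [opH_vecG_one hk, opH_vecG_eq_zero (by omega), map_zero]; rfl
    · rw [opH_vecG_add_two, map_zero, map_zero]; rfl
  · rw [opH_vecH ht, opH_vecH ht, opB_vecH_add_two]; rfl

theorem op_h2g (hk : 1 ≤ k) (ht : 2 ≤ t) :
    (opH * opH * opG : Module.End F (RegModule F k t)) = 0 := by
  refine linearMap_ext hk ?_ ?_ ?_ ?_ <;> intro l <;> simp only [Module.End.mul_apply]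
  · rw [opG_vecA]
    rcases l with _ | l
    · rw [opH_vecG_one hk, opH_vecG_eq_zero (by omega)]; rfl
    · rw [opH_vecG_add_two, map_zero]; rfl
  · rw [opH_opG_vecB hk ht]
    split_ifs
    · rw [opH_vecG_eq_zero (by omega)]; rfl
    · rw [map_zero]; rfl
  · simp [opG_vecG]
  · simp [opG_vecH]

theorem op_asq (hk : 1 ≤ k) (ht : 2 ≤ t) :
    (opA c * opA c : Module.End F (RegModule F k t)) = c • (opA c * opB * opG) ^ k := by
  refine linearMap_ext hk ?_ ?_ ?_ ?_ <;> intro l <;>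
    simp only [Module.End.mul_apply, LinearMap.smul_apply]
  · rw [opABG_pow_vecA hk]
    rcases l with _ | _ | l
    · rw [← vecB_zero, opA_vecB hk, opA_vecA_one hk, zero_add]
    · rw [zero_add, opA_vecA_one hk, map_smul, opA_vecA_eq_zero (by omega), vecA_eq_zero (by omega)]
    · rw [opA_vecA_add_two, vecA_eq_zero (by omega), map_zero, smul_zero]
  · obtain ⟨k, rfl⟩ := Nat.exists_eq_add_of_le' hk
    have : opA c (opB (opG (vecB (l + 1) : RegModule F (k + 1) t))) = 0 := by
      rcases l with _ | _ | l
      · rw [opG_vecB_one hk]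
        obtain ⟨_ | s, rfl⟩ := Nat.exists_eq_add_of_le' ht
        · rw [opB_vecH_one ht, opA_vecA_eq_zero (by omega)]
        · exact (congrArg _ (opB_vecH_add_two s)).trans (map_zero _)
      · rw [opG_vecB_two hk]
        split_ifs
        · rw [opB_vecG hk, opA_vecB hk, vecA_eq_zero (by omega)]
        · simp
      · rw [opG_vecB_add_three, map_zero, map_zero]
    rw [opA_vecB hk, opA_vecA_add_two, pow_succ]
    simp [this]
  · obtain ⟨k, rfl⟩ := Nat.exists_eq_add_of_le' hk
    simp [opA_vecG, pow_succ, opG_vecG]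
  · obtain ⟨k, rfl⟩ := Nat.exists_eq_add_of_le' hk
    simp [opA_vecH, pow_succ, opG_vecH]

theorem sdRels_regModule (hk : 1 ≤ k) (ht : 2 ≤ t) :
    SDRels k t c (opE1 : Module.End F (RegModule F k t)) opE2 (opA c) opB opG opH where
  unit := op_unit hk
  idem1 := op_idem1 hk
  idem2 := op_idem2 hk
  orth12 := op_orth12 hk
  orth21 := op_orth21 hk
  aL := op_aL hk
  aR := op_aR hk
  bL := op_bL hk ht
  bR := op_bR hk
  gL := op_gL hk
  gR := op_gR hk
  hL := op_hL hk ht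
  hR := op_hR hk
  bh := op_bh hk ht
  gb := op_gb hk ht
  hg := op_hg hk ht
  bh2 := op_bh2 hk ht
  h2g := op_h2g hk ht
  asq := op_asq hk ht

/-- The coordinate functional of a label. -/
def coord (r : Label) : RegModule F k t →ₗ[F] F :=
  Finsupp.linearCombination F fun r' : labels k t => if r'.1 = r then 1 else 0

theorem coord_basisVec (r r' : Label) : coord r (basisVec r' : RegModule F k t) =
    if r' ∈ labels k t ∧ r' = r then 1 else 0 := by
  unfold basisVec
  split_ifs <;> simp [coord] <;> grind

section Coordinates

variable {m : ℕ}

theorem coord_s1_vecA (hk : 1 ≤ k) (l : ℕ) :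
    coord .s1 (vecA l : RegModule F k t) = if l = 3 * k then 1 else 0 := by
  grind [coord_basisVec, vecA, s1_mem]

theorem coord_s1_vecB (hk : 1 ≤ k) (l : ℕ) :
    coord .s1 (vecB l : RegModule F k t) = if l = 3 * k then 1 else 0 := by
  grind [coord_basisVec, vecB, s1_mem]

theorem coord_s1_vecG (l : ℕ) : coord .s1 (vecG l : RegModule F k t) = 0 := by
  grind [coord_basisVec, vecG]

theorem coord_s1_vecH (l : ℕ) : coord .s1 (vecH l : RegModule F k t) = 0 := by
  grind [coord_basisVec, vecH]

theorem coord_s2_vecA (l : ℕ) : coord .s2 (vecA l : RegModule F k t) = 0 := by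
  grind [coord_basisVec, vecA]

theorem coord_s2_vecB (l : ℕ) : coord .s2 (vecB l : RegModule F k t) = 0 := by
  grind [coord_basisVec, vecB]

theorem coord_s2_vecG (hk : 1 ≤ k) (l : ℕ) :
    coord .s2 (vecG l : RegModule F k t) = if l = 3 * k then 1 else 0 := by
  grind [coord_basisVec, vecG, s2_mem]

theorem coord_s2_vecH (ht : 2 ≤ t) (l : ℕ) :
    coord .s2 (vecH l : RegModule F k t) = if l = t then 1 else 0 := by
  grind [coord_basisVec, vecH, s2_mem]

theorem coord_e1_vecA (l : ℕ) :
    coord .e1 (vecA l : RegModule F k t) = if l = 0 then 1 else 0 := by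
  grind [coord_basisVec, vecA, e1_mem]

theorem coord_e1_vecB (l : ℕ) :
    coord .e1 (vecB l : RegModule F k t) = if l = 0 then 1 else 0 := by
  grind [coord_basisVec, vecB, e1_mem]

theorem coord_e1_vecG (l : ℕ) : coord .e1 (vecG l : RegModule F k t) = 0 := by
  grind [coord_basisVec, vecG]

theorem coord_e1_vecH (l : ℕ) : coord .e1 (vecH l : RegModule F k t) = 0 := by
  grind [coord_basisVec, vecH]

theorem coord_e2_vecA (l : ℕ) : coord .e2 (vecA l : RegModule F k t) = 0 := by
  grind [coord_basisVec, vecA]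

theorem coord_e2_vecB (l : ℕ) : coord .e2 (vecB l : RegModule F k t) = 0 := by
  grind [coord_basisVec, vecB]

theorem coord_e2_vecG (l : ℕ) :
    coord .e2 (vecG l : RegModule F k t) = if l = 0 then 1 else 0 := by
  grind [coord_basisVec, vecG, e2_mem]

theorem coord_e2_vecH (l : ℕ) :
    coord .e2 (vecH l : RegModule F k t) = if l = 0 then 1 else 0 := by
  grind [coord_basisVec, vecH, e2_mem]

theorem coord_wa_vecA (h1 : 1 ≤ m) (hm : m < 3 * k) (l : ℕ) :
    coord (.wa m) (vecA l : RegModule F k t) = if l = m then 1 else 0 := by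
  grind [coord_basisVec, vecA, wa_mem]

theorem coord_wa_vecB (l : ℕ) : coord (.wa m) (vecB l : RegModule F k t) = 0 := by
  grind [coord_basisVec, vecB]

theorem coord_wa_vecG (l : ℕ) : coord (.wa m) (vecG l : RegModule F k t) = 0 := by
  grind [coord_basisVec, vecG]

theorem coord_wa_vecH (l : ℕ) : coord (.wa m) (vecH l : RegModule F k t) = 0 := by
  grind [coord_basisVec, vecH]

theorem coord_wb_vecA (l : ℕ) : coord (.wb m) (vecA l : RegModule F k t) = 0 := by
  grind [coord_basisVec, vecA]

theorem coord_wb_vecB (h1 : 1 ≤ m) (hm : m < 3 * k) (l : ℕ) :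
    coord (.wb m) (vecB l : RegModule F k t) = if l = m then 1 else 0 := by
  grind [coord_basisVec, vecB, wb_mem]

theorem coord_wb_vecG (l : ℕ) : coord (.wb m) (vecG l : RegModule F k t) = 0 := by
  grind [coord_basisVec, vecG]

theorem coord_wb_vecH (l : ℕ) : coord (.wb m) (vecH l : RegModule F k t) = 0 := by
  grind [coord_basisVec, vecH]

theorem coord_wg_vecA (l : ℕ) : coord (.wg m) (vecA l : RegModule F k t) = 0 := by
  grind [coord_basisVec, vecA]

theorem coord_wg_vecB (l : ℕ) : coord (.wg m) (vecB l : RegModule F k t) = 0 := by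
  grind [coord_basisVec, vecB]

theorem coord_wg_vecG (h1 : 1 ≤ m) (hm : m < 3 * k) (l : ℕ) :
    coord (.wg m) (vecG l : RegModule F k t) = if l = m then 1 else 0 := by
  grind [coord_basisVec, vecG, wg_mem]

theorem coord_wg_vecH (l : ℕ) : coord (.wg m) (vecH l : RegModule F k t) = 0 := by
  grind [coord_basisVec, vecH]

theorem coord_h_vecA (l : ℕ) : coord (.h m) (vecA l : RegModule F k t) = 0 := by
  grind [coord_basisVec, vecA]

theorem coord_h_vecB (l : ℕ) : coord (.h m) (vecB l : RegModule F k t) = 0 := by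
  grind [coord_basisVec, vecB]

theorem coord_h_vecG (l : ℕ) : coord (.h m) (vecG l : RegModule F k t) = 0 := by
  grind [coord_basisVec, vecG]

theorem coord_h_vecH (h1 : 1 ≤ m) (hm : m < t) (l : ℕ) :
    coord (.h m) (vecH l : RegModule F k t) = if l = m then 1 else 0 := by
  grind [coord_basisVec, vecH, h_mem]

end Coordinates

theorem coord_eq_apply {r : Label} (hr : r ∈ labels k t) (v : RegModule F k t) :
    coord r v = v ⟨r, hr⟩ := by
  have : (coord r : RegModule F k t →ₗ[F] F) = Finsupp.lapply ⟨r, hr⟩ := by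
    ext r'
    simp [coord, Finsupp.single_apply, Subtype.ext_iff]
  rw [this, Finsupp.lapply_apply]

theorem coord_comp_opE1 (hk : 1 ≤ k) : (coord .s1 + coord .s2 : RegModule F k t →ₗ[F] F) ∘ₗ opE1 =
    coord .s1 := by
  refine linearMap_ext hk ?_ ?_ ?_ ?_ <;> intro l <;>
    simp [opE1_vecA, opE1_vecB, opE1_vecG, opE1_vecH, coord_s2_vecA, coord_s2_vecB,
      coord_s1_vecG, coord_s1_vecH]

theorem coord_comp_opE2 (hk : 1 ≤ k) : (coord .s1 + coord .s2 : RegModule F k t →ₗ[F] F) ∘ₗ opE2 =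
    coord .s2 := by
  refine linearMap_ext hk ?_ ?_ ?_ ?_ <;> intro l <;>
    simp [opE2_vecA, opE2_vecB, opE2_vecG, opE2_vecH, coord_s2_vecA, coord_s2_vecB,
      coord_s1_vecG, coord_s1_vecH]

theorem coord_s1_comp_opA (hk : 1 ≤ k) : (coord .s1 : RegModule F k t →ₗ[F] F) ∘ₗ opA c =
    coord (.wb (3 * k - 1)) + c • coord (.wa 1) := by
  refine linearMap_ext hk ?_ ?_ ?_ ?_ <;> intro l <;> simp only [LinearMap.comp_apply,
    LinearMap.add_apply, LinearMap.smul_apply]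
  · rcases l with _ | _ | l
    · rw [← vecB_zero, opA_vecB hk, coord_s1_vecA hk, coord_wb_vecB (by omega) (by omega),
        coord_wa_vecB]; grind [smul_eq_mul]
    · rw [zero_add, opA_vecA_one hk, map_smul, coord_s1_vecA hk, coord_wb_vecA,
        coord_wa_vecA (by omega) (by omega)]; grind [smul_eq_mul]
    · rw [opA_vecA_add_two, coord_wb_vecA, coord_wa_vecA (by omega) (by omega)]
      grind [smul_eq_mul]
  · rw [opA_vecB hk, coord_s1_vecA hk, coord_wb_vecB (by omega) (by omega), coord_wa_vecB]
    grind [smul_eq_mul]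
  · simp [opA_vecG, coord_wb_vecG, coord_wa_vecG]
  · simp [opA_vecH, coord_wb_vecH, coord_wa_vecH]

theorem coord_wa_comp_opA {m : ℕ} (h1 : 1 ≤ m) (hm : m + 1 < 3 * k) :
    (coord (.wa (m + 1)) : RegModule F k t →ₗ[F] F) ∘ₗ opA c = coord (.wb m) := by
  refine linearMap_ext (by omega) ?_ ?_ ?_ ?_ <;> intro l <;> simp only [LinearMap.comp_apply]
  · rcases l with _ | _ | l
    · rw [← vecB_zero, opA_vecB (by omega), coord_wa_vecA (by omega) hm,
        coord_wb_vecB h1 (by omega)]; grind [smul_eq_mul]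
    · rw [zero_add, opA_vecA_one (by omega), map_smul, coord_wb_vecA,
        coord_wa_vecA (by omega) (by omega)]; grind [smul_eq_mul]
    · rw [opA_vecA_add_two, coord_wb_vecA, map_zero]
  · rw [opA_vecB (by omega), coord_wa_vecA (by omega) hm, coord_wb_vecB h1 (by omega)]
    grind [smul_eq_mul]
  · rw [opA_vecG, coord_wb_vecG, map_zero]
  · rw [opA_vecH, coord_wb_vecH, map_zero]

theorem coord_wa_one_comp_opA (hk : 1 ≤ k) :
    (coord (.wa 1) : RegModule F k t →ₗ[F] F) ∘ₗ opA c = coord .e1 := by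
  refine linearMap_ext hk ?_ ?_ ?_ ?_ <;> intro l <;> simp only [LinearMap.comp_apply]
  · rcases l with _ | _ | l
    · rw [← vecB_zero, opA_vecB hk, coord_wa_vecA (by omega) (by omega), coord_e1_vecB]
      grind [smul_eq_mul]
    · rw [zero_add, opA_vecA_one hk, map_smul, coord_e1_vecA,
        coord_wa_vecA (by omega) (by omega)]; grind [smul_eq_mul]
    · rw [opA_vecA_add_two, coord_e1_vecA, map_zero]
      grind [smul_eq_mul]
  · rw [opA_vecB hk, coord_wa_vecA (by omega) (by omega), coord_e1_vecB]
    grind [smul_eq_mul]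
  · rw [opA_vecG, coord_e1_vecG, map_zero]
  · rw [opA_vecH, coord_e1_vecH, map_zero]

theorem coord_s1_comp_opB (hk : 1 ≤ k) (ht : 2 ≤ t) :
    (coord .s1 : RegModule F k t →ₗ[F] F) ∘ₗ opB = coord (.wg (3 * k - 1)) := by
  refine linearMap_ext hk ?_ ?_ ?_ ?_ <;> intro l <;> simp only [LinearMap.comp_apply]
  · rw [opB_vecA, coord_wg_vecA, map_zero]
  · rw [opB_vecB, coord_wg_vecB, map_zero]
  · rw [opB_vecG hk, coord_s1_vecB hk, coord_wg_vecG (by omega) (by omega)]; grind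
  · rw [coord_wg_vecH]
    rcases l with _ | l
    · rw [zero_add, opB_vecH_one ht, coord_s1_vecA hk]; grind
    · rw [opB_vecH_add_two, map_zero]

theorem coord_wb_comp_opB (ht : 2 ≤ t) {m : ℕ} (h1 : 1 ≤ m) (hm : m + 1 < 3 * k) :
    (coord (.wb (m + 1)) : RegModule F k t →ₗ[F] F) ∘ₗ opB = coord (.wg m) := by
  refine linearMap_ext (by omega) ?_ ?_ ?_ ?_ <;> intro l <;> simp only [LinearMap.comp_apply]
  · rw [opB_vecA, coord_wg_vecA, map_zero]
  · rw [opB_vecB, coord_wg_vecB, map_zero]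
  · rw [opB_vecG (by omega), coord_wb_vecB (by omega) hm, coord_wg_vecG h1 (by omega)]; grind
  · rw [coord_wg_vecH]
    rcases l with _ | l
    · rw [zero_add, opB_vecH_one ht, coord_wb_vecA]
    · rw [opB_vecH_add_two, map_zero]

theorem coord_wa_one_comp_opB (hk : 1 ≤ k) (ht : 2 ≤ t) :
    (coord (.wa 1) : RegModule F k t →ₗ[F] F) ∘ₗ opB = 0 := by
  refine linearMap_ext hk ?_ ?_ ?_ ?_ <;> intro l <;> simp only [LinearMap.comp_apply,
    LinearMap.zero_apply]
  · rw [opB_vecA, map_zero]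
  · rw [opB_vecB, map_zero]
  · rw [opB_vecG hk, coord_wa_vecB]
  · rcases l with _ | l
    · rw [zero_add, opB_vecH_one ht, coord_wa_vecA (by omega) (by omega), if_neg (by omega)]
    · rw [opB_vecH_add_two, map_zero]

theorem coord_s2_comp_opG (hk : 1 ≤ k) (ht : 2 ≤ t) :
    (coord .s2 : RegModule F k t →ₗ[F] F) ∘ₗ opG = coord (.wa (3 * k - 1)) := by
  refine linearMap_ext hk ?_ ?_ ?_ ?_ <;> intro l <;> simp only [LinearMap.comp_apply]
  · rw [opG_vecA, coord_s2_vecG hk, coord_wa_vecA (by omega) (by omega)]; grind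
  · rw [coord_wa_vecB]
    rcases l with _ | _ | l
    · rw [zero_add, opG_vecB_one hk, coord_s2_vecH ht, if_neg (by omega)]
    · rw [opG_vecB_two hk, apply_ite (coord Label.s2), coord_s2_vecG hk, map_zero]; grind
    · rw [opG_vecB_add_three, map_zero]
  · rw [opG_vecG, coord_wa_vecG, map_zero]
  · rw [opG_vecH, coord_wa_vecH, map_zero]

theorem coord_wg_comp_opG {m : ℕ} (h1 : 1 ≤ m) (hm : m + 1 < 3 * k) :
    (coord (.wg (m + 1)) : RegModule F k t →ₗ[F] F) ∘ₗ opG =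
      coord (.wa m) + if t = 2 ∧ m + 2 = 3 * k then coord (.wb 2) else 0 := by
  refine linearMap_ext (by omega) ?_ ?_ ?_ ?_ <;> intro l <;> simp only [LinearMap.comp_apply,
    LinearMap.add_apply]
  · rw [opG_vecA, coord_wg_vecG (by omega) hm, coord_wa_vecA h1 (by omega)]
    split_ifs <;> simp_all [coord_wb_vecA]
  · rw [coord_wa_vecB]
    rcases l with _ | _ | l
    · rw [zero_add, opG_vecB_one (by omega), coord_wg_vecH]
      split_ifs
      · rw [coord_wb_vecB (by omega) (by omega)]; grind
      · simp
    · rw [opG_vecB_two (by omega), apply_ite (coord _), coord_wg_vecG (by omega) hm, map_zero]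
      split_ifs
      any_goals rw [coord_wb_vecB (by omega) (by omega)]
      all_goals simp
      all_goals omega
    · rw [opG_vecB_add_three, map_zero]
      split_ifs
      · rw [coord_wb_vecB (by omega) (by omega)]; grind
      · simp
  · rw [opG_vecG, coord_wa_vecG, map_zero]
    split_ifs <;> simp [coord_wb_vecG]
  · rw [opG_vecH, coord_wa_vecH, map_zero]
    split_ifs <;> simp [coord_wb_vecH]

theorem coord_s2_comp_opH (hk : 1 ≤ k) (ht : 2 ≤ t) :
    (coord .s2 : RegModule F k t →ₗ[F] F) ∘ₗ opH = coord (.h (t - 1)) := by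
  refine linearMap_ext hk ?_ ?_ ?_ ?_ <;> intro l <;> simp only [LinearMap.comp_apply]
  · rw [opH_vecA, coord_h_vecA, map_zero]
  · rw [opH_vecB, coord_h_vecB, map_zero]
  · rw [coord_h_vecG]
    rcases l with _ | _ | l
    · rw [← vecH_zero, opH_vecH ht, coord_s2_vecH ht, if_neg (by omega)]
    · rw [zero_add, opH_vecG_one hk, coord_s2_vecG hk, if_neg (by omega)]
    · rw [opH_vecG_add_two, map_zero]
  · rw [opH_vecH ht, coord_s2_vecH ht, coord_h_vecH (by omega) (by omega)]; grind

theorem coord_h_comp_opH (hk : 1 ≤ k) (ht : 2 ≤ t) {m : ℕ} (h1 : 1 ≤ m) (hm : m + 1 < t) :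
    (coord (.h (m + 1)) : RegModule F k t →ₗ[F] F) ∘ₗ opH = coord (.h m) := by
  refine linearMap_ext hk ?_ ?_ ?_ ?_ <;> intro l <;> simp only [LinearMap.comp_apply]
  · rw [opH_vecA, coord_h_vecA, map_zero]
  · rw [opH_vecB, coord_h_vecB, map_zero]
  · rw [coord_h_vecG]
    rcases l with _ | _ | l
    · rw [← vecH_zero, opH_vecH ht, coord_h_vecH (by omega) hm, if_neg (by omega)]
    · rw [zero_add, opH_vecG_one hk, coord_h_vecG]
    · rw [opH_vecG_add_two, map_zero]
  · rw [opH_vecH ht, coord_h_vecH (by omega) hm, coord_h_vecH h1 (by omega)]; grind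

theorem coord_h_one_comp_opH (hk : 1 ≤ k) (ht : 2 ≤ t) :
    (coord (.h 1) : RegModule F k t →ₗ[F] F) ∘ₗ opH = coord .e2 := by
  refine linearMap_ext hk ?_ ?_ ?_ ?_ <;> intro l <;> simp only [LinearMap.comp_apply]
  · rw [opH_vecA, coord_e2_vecA, map_zero]
  · rw [opH_vecB, coord_e2_vecB, map_zero]
  · rcases l with _ | _ | l
    · rw [← vecH_zero, opH_vecH ht, coord_h_vecH (by omega) (by omega), coord_e2_vecH]; grind
    · rw [zero_add, opH_vecG_one hk, coord_h_vecG, coord_e2_vecG]; grind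
    · rw [opH_vecG_add_two, map_zero, coord_e2_vecG]; grind
  · rw [opH_vecH ht, coord_h_vecH (by omega) (by omega), coord_e2_vecH]; grind

theorem eq_bot_of_coord (hk : 1 ≤ k) (ht : 2 ≤ t) (hkt : 4 ≤ k + t)
    {N : Submodule F (RegModule F k t)}
    (hS : ∀ v ∈ N, (coord .s1 + coord .s2 : RegModule F k t →ₗ[F] F) v = 0)
    (hE1 : ∀ v ∈ N, opE1 v ∈ N) (hE2 : ∀ v ∈ N, opE2 v ∈ N) (hA : ∀ v ∈ N, opA c v ∈ N)
    (hB : ∀ v ∈ N, opB v ∈ N) (hG : ∀ v ∈ N, opG v ∈ N) (hH : ∀ v ∈ N, opH v ∈ N) : N = ⊥ := by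
  have step : ∀ {f g : RegModule F k t →ₗ[F] F} {T : Module.End F (RegModule F k t)},
      f ∘ₗ T = g → (∀ v ∈ N, T v ∈ N) → (∀ v ∈ N, f v = 0) → ∀ v ∈ N, g v = 0 := by
    rintro f _ T rfl hT hf v hv
    exact hf _ (hT v hv)
  have s1 := step (coord_comp_opE1 hk) hE1 hS
  have s2 := step (coord_comp_opE2 hk) hE2 hS
  have top := step (coord_s1_comp_opA hk) hA s1
  have chainA : ∀ {m : ℕ}, 1 ≤ m → m + 1 < 3 * k → (∀ v ∈ N, coord (.wa (m + 1)) v = 0) →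
      ∀ v ∈ N, coord (.wb m) v = 0 := fun h1 hm => step (coord_wa_comp_opA h1 hm) hA
  have chainB : ∀ {m : ℕ}, 1 ≤ m → m + 1 < 3 * k → (∀ v ∈ N, coord (.wb (m + 1)) v = 0) →
      ∀ v ∈ N, coord (.wg m) v = 0 := fun h1 hm => step (coord_wb_comp_opB ht h1 hm) hB
  have chainG : ∀ {m : ℕ}, 1 ≤ m → m + 2 < 3 * k → (∀ v ∈ N, coord (.wg (m + 1)) v = 0) →
      ∀ v ∈ N, coord (.wa m) v = 0 := fun h1 hm =>
    step ((coord_wg_comp_opG h1 (by omega)).trans (by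
      rw [if_neg (by omega), add_zero])) hG
  have waTop := step (coord_s2_comp_opG hk ht) hG s2
  have wgTop := step (coord_s1_comp_opB hk ht) hB s1
  have wgSub : ∀ v ∈ N, coord (.wg (3 * k - 2)) v = 0 := by
    refine step ?_ hB top
    rw [LinearMap.add_comp, LinearMap.smul_comp, coord_wa_one_comp_opB hk ht, smul_zero,
      add_zero, show 3 * k - 1 = 3 * k - 2 + 1 by omega, coord_wb_comp_opB ht (by omega) (by omega)]
  have first : ∀ j i : ℕ, i + j + 1 = k → ∀ v ∈ N, coord (.wg (3 * i + 1)) v = 0 := by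
    intro j
    induction j with
    | zero =>
      intro i hi
      rwa [show 3 * i + 1 = 3 * k - 2 by omega]
    | succ j ih =>
      intro i hi
      exact chainB (by omega) (by omega) <| chainA (by omega) (by omega) <|
        chainG (m := 3 * i + 3) (by omega) (by omega) (ih (i + 1) (by omega))
  have correction : t = 2 → ∀ v ∈ N, coord (.wb 2) v = 0 := fun h2 =>
    chainA (by omega) (by omega) <| chainG (by omega) (by omega) <| first (k - 2) 1 (by omega)
  have waSub : ∀ v ∈ N, coord (.wa (3 * k - 2)) v = 0 := by
    intro v hv
    have h := step (coord_wg_comp_opG (m := 3 * k - 2) (by omega) (by omega)) hG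
      (by rwa [show 3 * k - 2 + 1 = 3 * k - 1 by omega]) v hv
    split_ifs at h with h2
    · simpa [correction h2.1 v hv] using h
    · simpa using h
  have all : ∀ j m : ℕ, m + j + 2 = 3 * k → 1 ≤ m → (∀ v ∈ N, coord (.wa m) v = 0) ∧
      (∀ v ∈ N, coord (.wb m) v = 0) ∧ ∀ v ∈ N, coord (.wg m) v = 0 := by
    intro j
    induction j with
    | zero =>
      intro m hm h1
      obtain rfl : m = 3 * k - 2 := by omega
      exact ⟨waSub, chainA h1 (by omega) (by rwa [show 3 * k - 2 + 1 = 3 * k - 1 by omega]), wgSub⟩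
    | succ j ih =>
      intro m hm h1
      obtain ⟨ha, hb, hg⟩ := ih (m + 1) (by omega) (by omega)
      exact ⟨chainG h1 (by omega) hg, chainA h1 (by omega) ha, chainB h1 (by omega) hb⟩
  have wa1 := (all (3 * k - 3) 1 (by omega) le_rfl).1
  have wbTop : ∀ v ∈ N, coord (.wb (3 * k - 1)) v = 0 := by
    intro v hv
    simpa [wa1 v hv] using top v hv
  have e1 := step (coord_wa_one_comp_opA hk) hA wa1
  have h : ∀ j m : ℕ, m + j + 1 = t → 1 ≤ m → ∀ v ∈ N, coord (.h m) v = 0 := by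
    intro j
    induction j with
    | zero =>
      rintro m rfl -
      simpa using step (coord_s2_comp_opH hk ht) hH s2
    | succ j ih =>
      intro m hm h1
      exact step (coord_h_comp_opH hk ht h1 (by omega)) hH (ih _ (by omega) (by omega))
  have e2 := step (coord_h_one_comp_opH hk ht) hH (h (t - 2) 1 (by omega) le_rfl)
  refine (Submodule.eq_bot_iff _).2 fun v hv => Finsupp.ext fun ⟨r, hr⟩ => ?_
  have hv0 : coord r v = 0 := by
    cases r with
    | e1 => exact e1 v hv
    | e2 => exact e2 v hv
    | s1 => exact s1 v hv
    | s2 => exact s2 v hv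
    | wa l =>
      rw [wa_mem] at hr
      obtain h | rfl : l + (3 * k - l - 2) + 2 = 3 * k ∨ l = 3 * k - 1 := by omega
      · exact (all _ l h hr.1).1 v hv
      · exact waTop v hv
    | wb l =>
      rw [wb_mem] at hr
      obtain h | rfl : l + (3 * k - l - 2) + 2 = 3 * k ∨ l = 3 * k - 1 := by omega
      · exact (all _ l h hr.1).2.1 v hv
      · exact wbTop v hv
    | wg l =>
      rw [wg_mem] at hr
      obtain h | rfl : l + (3 * k - l - 2) + 2 = 3 * k ∨ l = 3 * k - 1 := by omega
      · exact (all _ l h hr.1).2.2 v hv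
      · exact wgTop v hv
    | h l =>
      rw [h_mem] at hr
      exact h (t - l - 1) l (by omega) hr.1 v hv
  rw [← coord_eq_apply hr]
  exact hv0

section Evaluation

variable (hk : 1 ≤ k) (ht : 2 ≤ t) (hkt : 4 ≤ k + t)

/-- The algebra acts on the regular module. -/
def regRep : BA F k t c →ₐ[F] Module.End F (RegModule F k t) :=
  (sdRels_regModule (F := F) (c := c) hk ht).exists_lift.choose

theorem regRep_gen :
    regRep hk ht (E1 F k t c) = opE1 ∧ regRep hk ht (E2 F k t c) = opE2 ∧
    regRep hk ht (Al F k t c) = opA c ∧ regRep hk ht (Be F k t c) = opB ∧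
    regRep hk ht (Ga F k t c) = opG ∧ regRep hk ht (Et F k t c) = opH :=
  (sdRels_regModule (F := F) (c := c) hk ht).exists_lift.choose_spec

theorem regRep_Al : regRep hk ht (Al F k t c) = opA c := (regRep_gen hk ht).2.2.1
theorem regRep_Be : regRep hk ht (Be F k t c) = opB := (regRep_gen hk ht).2.2.2.1
theorem regRep_Ga : regRep hk ht (Ga F k t c) = opG := (regRep_gen hk ht).2.2.2.2.1

/-- The action on the unit vector of the regular module. -/
def regEval : BA F k t c →ₗ[F] RegModule F k t :=
  LinearMap.applyₗ (vecA 0 + vecG 0) ∘ₗ (regRep hk ht).toLinearMap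

theorem regEval_apply (x : BA F k t c) :
    regEval hk ht x = regRep hk ht x (vecA 0 + vecG 0) := rfl

theorem regEval_mul (x y : BA F k t c) :
    regEval hk ht (x * y) = regRep hk ht x (regEval hk ht y) := by
  rw [regEval_apply, map_mul, Module.End.mul_apply, regEval_apply]

theorem regEval_surjective : Function.Surjective (regEval hk ht : BA F k t c →ₗ[F] _) := by
  obtain ⟨h1, h2, ha, hb, hg, hh⟩ := regRep_gen (F := F) (c := c) hk ht
  set p := LinearMap.range (regEval hk ht : BA F k t c →ₗ[F] _)
  have hp : ∀ (x : BA F k t c) (v), v ∈ p → regRep hk ht x v ∈ p := by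
    rintro x _ ⟨y, rfl⟩
    exact ⟨x * y, regEval_mul hk ht x y⟩
  have h0 : vecA 0 + vecG 0 ∈ p := ⟨1, by simp [regEval_apply]⟩
  have hA0 : vecA 0 ∈ p := by
    have := hp (E1 F k t c) _ h0
    rwa [h1, map_add, opE1_vecA, opE1_vecG, add_zero] at this
  have hG0 : vecG 0 ∈ p := by
    have := hp (E2 F k t c) _ h0
    rwa [h2, map_add, opE2_vecA, opE2_vecG, zero_add] at this
  have key : ∀ l, vecA l ∈ p ∧ vecB l ∈ p ∧ vecG l ∈ p := by
    intro l
    induction l with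
    | zero => exact ⟨hA0, vecB_zero (F := F) (k := k) ▸ hA0, hG0⟩
    | succ l ih =>
      obtain ⟨hA, hB, hG⟩ := ih
      refine ⟨?_, ?_, ?_⟩
      · have := hp (Al F k t c) _ hB
        rwa [ha, opA_vecB hk] at this
      · have := hp (Be F k t c) _ hG
        rwa [hb, opB_vecG hk] at this
      · have := hp (Ga F k t c) _ hA
        rwa [hg, opG_vecA] at this
  have hH : ∀ l, vecH l ∈ p := by
    intro l
    induction l with
    | zero => rwa [vecH_zero]
    | succ l ih =>
      have := hp (Et F k t c) _ ih
      rwa [hh, opH_vecH ht] at this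
  exact LinearMap.range_eq_top.1 <| eq_top_of_vec_mem hk (fun l => (key l).1)
    (fun l => (key _).2.1) (fun l => (key l).2.2) fun l => hH _

include hk ht in
theorem finrank_regModule : Module.finrank F (RegModule F k t) = 9 * k + t := by
  rw [Module.finrank_finsupp_self, Fintype.card_coe, card_labels _ _ hk (by omega)]

include hk ht in
theorem span_families_BA [CharP F 2] : Submodule.span F (Set.range
    (Sum.elim (SDRels.commutatorFamily k (Al F k t c) (Be F k t c) (Ga F k t c))
      (SDRels.complementFamily k t (E1 F k t c) (E2 F k t c) (Al F k t c) (Be F k t c)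
        (Ga F k t c) (Et F k t c)))) = ⊤ :=
  sdRels_BA.span_families hk ht CharTwo.two_eq_zero adjoin_BA

include hk ht in
theorem finite_BA [CharP F 2] : Module.Finite F (BA F k t c) :=
  Module.finite_def.2 (span_families_BA (F := F) (c := c) hk ht ▸ Submodule.fg_span (Set.finite_range _))

include hk ht in
theorem finrank_BA [CharP F 2] : Module.finrank F (BA F k t c) = 9 * k + t := by
  have := finite_BA (F := F) (c := c) hk ht
  refine le_antisymm ?_ ?_
  · rw [← finrank_top, ← span_families_BA hk ht]
    refine (finrank_range_le_card _).trans ?_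
    simp
    omega
  · rw [← finrank_regModule (F := F) hk ht]
    exact LinearMap.finrank_le_finrank_of_surjective (regEval_surjective hk ht)

include hk ht in
theorem linearIndependent_commutatorFamily [CharP F 2] : LinearIndependent F
    (SDRels.commutatorFamily k (Al F k t c) (Be F k t c) (Ga F k t c)) := by
  have := (linearIndependent_of_top_le_span_of_card_eq_finrank
    (span_families_BA (F := F) (c := c) hk ht).ge (by
      rw [finrank_BA hk ht]
      simp
      omega)).comp _ Sum.inl_injective
  exact this

theorem regEval_injective [CharP F 2] :
    Function.Injective (regEval hk ht : BA F k t c →ₗ[F] _) := by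
  have := finite_BA (F := F) (c := c) hk ht
  refine (LinearMap.injective_iff_surjective_of_finrank_eq_finrank ?_).2
    (regEval_surjective hk ht)
  rw [finrank_BA hk ht, finrank_regModule hk ht]

/-- The sum of the two socle coordinates. -/
def socleForm : BA F k t c →ₗ[F] F := (coord .s1 + coord .s2) ∘ₗ regEval hk ht

theorem socleForm_commutatorFamily [CharP F 2] (i) : socleForm hk ht
    (SDRels.commutatorFamily k (Al F k t c) (Be F k t c) (Ga F k t c) i) = 0 := by
  have ea : regEval hk ht (Al F k t c) = vecA 1 := by
    rw [regEval_apply, regRep_Al, map_add, ← vecB_zero, opA_vecB hk, opA_vecG, add_zero]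
  have eb : regEval hk ht (Be F k t c) = vecB 1 := by
    rw [regEval_apply, regRep_Be, map_add, opB_vecA, opB_vecG hk, zero_add]
  have eg : regEval hk ht (Ga F k t c) = vecG 1 := by
    rw [regEval_apply, regRep_Ga, map_add, opG_vecA, opG_vecG, add_zero]
  have pu : ∀ (n : ℕ) x l, regEval hk ht x = vecA l → regEval hk ht
      ((Al F k t c * Be F k t c * Ga F k t c) ^ n * x) = vecA (l + 3 * n) := by
    intro n x l hx
    rw [regEval_mul, hx, map_pow, map_mul, map_mul, regRep_Al, regRep_Be, regRep_Ga,
      opABG_pow_vecA hk]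
  have pv : ∀ (n : ℕ) x l, regEval hk ht x = vecB l → regEval hk ht
      ((Be F k t c * Ga F k t c * Al F k t c) ^ n * x) = vecB (l + 3 * n) := by
    intro n x l hx
    rw [regEval_mul, hx, map_pow, map_mul, map_mul, regRep_Al, regRep_Be, regRep_Ga,
      opBGA_pow_vecB hk]
  have pw : ∀ (n : ℕ) x l, regEval hk ht x = vecG l → regEval hk ht
      ((Ga F k t c * Al F k t c * Be F k t c) ^ n * x) = vecG (l + 3 * n) := by
    intro n x l hx
    rw [regEval_mul, hx, map_pow, map_mul, map_mul, regRep_Al, regRep_Be, regRep_Ga,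
      opGAB_pow_vecG hk]
  have eab : regEval hk ht (Al F k t c * Be F k t c) = vecA 2 := by
    rw [regEval_mul, eb, regRep_Al, opA_vecB hk]
  have ebg : regEval hk ht (Be F k t c * Ga F k t c) = vecB 2 := by
    rw [regEval_mul, eg, regRep_Be, opB_vecG hk]
  have ega : regEval hk ht (Ga F k t c * Al F k t c) = vecG 2 := by
    rw [regEval_mul, ea, regRep_Ga, opG_vecA]
  have egb : regEval hk ht (Ga F k t c * Be F k t c) = vecH (t - 1) := by
    rw [regEval_mul, eb, regRep_Ga, opG_vecB_one hk]
  have eu : regEval hk ht (Al F k t c * Be F k t c * Ga F k t c) = vecA 3 := by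
    rw [mul_assoc, regEval_mul, ebg, regRep_Al, opA_vecB hk]
  have ev : regEval hk ht (Be F k t c * Ga F k t c * Al F k t c) = vecB 3 := by
    rw [mul_assoc, regEval_mul, ega, regRep_Be, opB_vecG hk]
  have ew : regEval hk ht (Ga F k t c * Al F k t c * Be F k t c) = vecG 3 := by
    rw [mul_assoc, regEval_mul, eab, regRep_Ga, opG_vecA]
  have sA : ∀ l, (coord .s1 + coord .s2 : RegModule F k t →ₗ[F] F) (vecA l) =
      if l = 3 * k then 1 else 0 := fun l => by
    rw [LinearMap.add_apply, coord_s1_vecA hk, coord_s2_vecA, add_zero]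
  have sB : ∀ l, (coord .s1 + coord .s2 : RegModule F k t →ₗ[F] F) (vecB l) =
      if l = 3 * k then 1 else 0 := fun l => by
    rw [LinearMap.add_apply, coord_s1_vecB hk, coord_s2_vecB, add_zero]
  have sG : ∀ l, (coord .s1 + coord .s2 : RegModule F k t →ₗ[F] F) (vecG l) =
      if l = 3 * k then 1 else 0 := fun l => by
    rw [LinearMap.add_apply, coord_s1_vecG, coord_s2_vecG hk, zero_add]
  have sH : ∀ l, (coord .s1 + coord .s2 : RegModule F k t →ₗ[F] F) (vecH l) =
      if l = t then 1 else 0 := fun l => by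
    rw [LinearMap.add_apply, coord_s1_vecH, coord_s2_vecH ht, zero_add]
  rcases i with (n | n | n | n) | (_ | n | n | n) | n <;>
    simp only [SDRels.commutatorFamily, Sum.elim_inl, Sum.elim_inr, socleForm,
      LinearMap.comp_apply, map_add (regEval hk ht)]
  · rw [pv _ _ _ eb, sB, if_neg (by omega)]
  · rw [pu _ _ _ eab, sA, if_neg (by omega)]
  · rw [pw _ _ _ eg, sG, if_neg (by omega)]
  · rw [pw _ _ _ ega, sG, if_neg (by omega)]
  · rw [ebg, egb, map_add, sB, sH, if_neg (by omega), if_neg (by omega), add_zero]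
  · rw [pow_succ, pow_succ, pu _ _ _ eu, pv _ _ _ ev, map_add, sA, sB, CharTwo.add_self_eq_zero]
  · rw [pu _ _ _ ea, sA, if_neg (by omega)]
  · rw [pv _ _ _ ebg, sB, if_neg (by omega)]
  · rw [pow_succ, pow_succ, pu _ _ _ eu, pw _ _ _ ew, map_add, sA, sG, CharTwo.add_self_eq_zero]

include hk ht in
theorem commutatorSpan_BA [CharP F 2] : SDRels.commutatorSpan F k (Al F k t c) (Be F k t c)
    (Ga F k t c) = Kspan F (BA F k t c) :=
  sdRels_BA.commutatorSpan_eq hk ht CharTwo.two_eq_zero adjoin_BA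

theorem socleForm_mul_comm [CharP F 2] (x y : BA F k t c) :
    socleForm hk ht (x * y) = socleForm hk ht (y * x) := by
  have hle : Kspan F (BA F k t c) ≤ LinearMap.ker (socleForm hk ht) := by
    rw [← commutatorSpan_BA hk ht, SDRels.commutatorSpan, Submodule.span_le]
    rintro _ ⟨i, rfl⟩
    exact socleForm_commutatorFamily hk ht i
  have := hle (Submodule.subset_span ⟨x, y, rfl⟩)
  rwa [LinearMap.mem_ker, map_sub, sub_eq_zero] at this

include hkt in
theorem eq_zero_of_socleForm [CharP F 2] {x : BA F k t c}
    (hx : ∀ y, socleForm hk ht (y * x) = 0) : x = 0 := by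
  obtain ⟨h1, h2, ha, hb, hg, hh⟩ := regRep_gen (F := F) (c := c) hk ht
  let N : Submodule F (RegModule F k t) :=
    ⨅ y : BA F k t c, LinearMap.ker ((coord .s1 + coord .s2) ∘ₗ regRep hk ht y)
  have mem_N : ∀ v, v ∈ N ↔
      ∀ y : BA F k t c,
      (coord .s1 + coord .s2 : RegModule F k t →ₗ[F] F) (regRep hk ht y v) = 0 := by
    simp [N]
  have hN : ∀ (y : BA F k t c) (v), v ∈ N → regRep hk ht y v ∈ N := by
    intro y v hv
    rw [mem_N] at hv ⊢
    intro z
    rw [← Module.End.mul_apply, ← map_mul]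
    exact hv _
  have : N = ⊥ := by
    refine eq_bot_of_coord (c := c) hk ht hkt (fun v hv => ?_) (fun v hv => ?_) (fun v hv => ?_)
      (fun v hv => ?_) (fun v hv => ?_) (fun v hv => ?_) fun v hv => ?_
    · simpa using (mem_N v).1 hv 1
    · exact h1 ▸ hN _ v hv
    · exact h2 ▸ hN _ v hv
    · exact ha ▸ hN _ v hv
    · exact hb ▸ hN _ v hv
    · exact hg ▸ hN _ v hv
    · exact hh ▸ hN _ v hv
  refine regEval_injective (F := F) (c := c) hk ht ?_
  rw [map_zero, ← Submodule.mem_bot F, ← this, mem_N]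
  intro y
  rw [← regEval_mul]
  exact hx y

end Evaluation

theorem finrank_center_of_symmetric_form {A : Type} [Ring A] [Algebra F A] [Module.Finite F A]
    (f : A →ₗ[F] F) (hf : ∀ x y, f (x * y) = f (y * x))
    (hf0 : ∀ x, (∀ y, f (y * x) = 0) → x = 0) :
    Module.finrank F (Subalgebra.center F A) =
      Module.finrank F A - Module.finrank F (Kspan F A) := by
  let B : LinearMap.BilinForm F A := (LinearMap.mul F A).compr₂ f
  have hB : ∀ x y, B x y = f (x * y) := fun x y => rfl
  have hB0 : B.Nondegenerate :=
    ⟨fun x hx => hf0 x fun y => (hf y x).trans (hx y), fun x hx => hf0 x fun y => hx y⟩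
  rw [← LinearMap.BilinForm.finrank_orthogonal hB0]
  have key : B.orthogonal (Kspan F A) = Subalgebra.toSubmodule (Subalgebra.center F A) := by
    ext z
    rw [LinearMap.BilinForm.mem_orthogonal_iff, Subalgebra.mem_toSubmodule,
      Subalgebra.mem_center_iff]
    have swap : ∀ x y, f ((x * y - y * x) * z) = f (x * (y * z - z * y)) := by
      intro x y
      rw [sub_mul, mul_sub, map_sub, map_sub, mul_assoc, mul_assoc y, hf y, mul_assoc x]
    constructor
    · intro hz y
      refine sub_eq_zero.1 (hf0 _ fun x => ?_)
      rw [← swap, ← hB]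
      exact hz _ (Submodule.subset_span ⟨x, y, rfl⟩)
    · intro hz n hn
      change f (n * z) = 0
      induction hn using Submodule.span_induction with
      | mem n hn =>
        obtain ⟨x, y, rfl⟩ := hn
        rw [swap, hz, sub_self, mul_zero, map_zero]
      | zero => rw [zero_mul, map_zero]
      | add n m _ _ hn hm => rw [add_mul, map_add, hn, hm, add_zero]
      | smul r n _ hn => rw [smul_mul_assoc, map_smul, hn, smul_zero]
  rw [key]
  rfl

theorem range_commutatorFamily (hk : 1 ≤ k) :
    Set.range (SDRels.commutatorFamily k (Al F k t c) (Be F k t c) (Ga F k t c)) = KK F k t c := by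
  have range_succ : ∀ f : ℕ → BA F k t c,
      Set.range (fun n : Fin k => f n.1) = {f 0} ∪ f '' Set.Icc 1 (k - 1) := by
    intro f
    ext x
    simp only [Set.mem_range, Set.mem_union, Set.mem_singleton_iff, Set.mem_image, Set.mem_Icc]
    constructor
    · rintro ⟨⟨_ | n, hn⟩, rfl⟩
      · exact .inl rfl
      · exact .inr ⟨n + 1, by omega, rfl⟩
    · rintro (rfl | ⟨n, hn, rfl⟩)
      · exact ⟨⟨0, by omega⟩, rfl⟩
      · exact ⟨⟨n, by omega⟩, rfl⟩
  have range_Icc : ∀ (m : ℕ) (f : ℕ → BA F k t c),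
      Set.range (fun n : Fin m => f (n.1 + 1)) = f '' Set.Icc 1 m := by
    intro m f
    ext x
    simp only [Set.mem_range, Set.mem_image, Set.mem_Icc]
    constructor
    · rintro ⟨n, rfl⟩
      exact ⟨n + 1, by omega, rfl⟩
    · rintro ⟨n, hn, rfl⟩
      obtain ⟨n, rfl⟩ := Nat.exists_eq_add_of_le' hn.1
      exact ⟨⟨n, by omega⟩, rfl⟩
  simp only [SDRels.commutatorFamily, Set.Sum.elim_range, Set.range_const]
  rw [range_succ fun n => (Be F k t c * Ga F k t c * Al F k t c) ^ n * Be F k t c,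
    range_succ fun n => (Al F k t c * Be F k t c * Ga F k t c) ^ n * (Al F k t c * Be F k t c),
    range_succ fun n => (Ga F k t c * Al F k t c * Be F k t c) ^ n * Ga F k t c,
    range_succ fun n => (Ga F k t c * Al F k t c * Be F k t c) ^ n * (Ga F k t c * Al F k t c),
    range_Icc _ fun n => (Al F k t c * Be F k t c * Ga F k t c) ^ n +
      (Be F k t c * Ga F k t c * Al F k t c) ^ n,
    range_Icc _ fun n => (Al F k t c * Be F k t c * Ga F k t c) ^ n * Al F k t c,
    range_Icc _ fun n => (Be F k t c * Ga F k t c * Al F k t c) ^ n * (Be F k t c * Ga F k t c),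
    range_Icc _ fun n => (Al F k t c * Be F k t c * Ga F k t c) ^ n +
      (Ga F k t c * Al F k t c * Be F k t c) ^ n]
  simp only [pow_zero, one_mul, KK, B12, B21, K11, K22, ABG, BGA, GAB, Set.insert_eq]
  ac_rfl

end RegularModule

set_option synthInstance.maxHeartbeats 1000000 in
/-- **Basis of the commutator subspace of `B^{k,t}_c` (semidihedral type, second
family).**  For `k ≥ 1`, `t ≥ 2` with `k + t ≥ 4` and `c ∈ {0,1}` the set 𝓚 is an
F-basis of `K(B^{k,t}_c)`; in particular
`dim_F K(B^{k,t}_c) = 8k - 2 = dim_F B^{k,t}_c - dim_F Z(B^{k,t}_c)`. -/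
theorem semidihedral_two_commutator_basis
    (F : Type) [Field F] [IsAlgClosed F] [CharP F 2]
    (k t : ℕ) (hk : 1 ≤ k) (ht : 2 ≤ t) (hkt : 4 ≤ k + t) (c : F) (hc : c = 0 ∨ c = 1) :
    LinearIndependent F (fun p : (KK F k t c) => (p : BA F k t c)) ∧
    Submodule.span F (KK F k t c) = Kspan F (BA F k t c) ∧
    Module.finrank F ↥(Kspan F (BA F k t c)) = 8 * k - 2 ∧
    8 * k - 2
      = Module.finrank F (BA F k t c)
          - Module.finrank F ↥(Subalgebra.center F (BA F k t c)) := by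
  have hfin := finite_BA (F := F) (c := c) hk ht
  have hli := linearIndependent_commutatorFamily (F := F) (c := c) hk ht
  have hspan := commutatorSpan_BA (F := F) (c := c) hk ht
  rw [SDRels.commutatorSpan] at hspan
  have hrank : Module.finrank F (Kspan F (BA F k t c)) = 8 * k - 2 := by
    rw [← hspan, finrank_span_eq_card hli]
    simp
    omega
  refine ⟨?_, ?_, hrank, ?_⟩
  · rw [← range_commutatorFamily hk]
    exact hli.linearIndepOn_id
  · rw [← range_commutatorFamily hk, hspan]
  · rw [finrank_center_of_symmetric_form (socleForm hk ht) (socleForm_mul_comm hk ht)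
      fun x => eq_zero_of_socleForm hk ht hkt, hrank, finrank_BA hk ht]
    omega

end SD2Paper

end
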